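/- arXiv:1702.04529 — 3 statements merged into one kernel-verified Lean document; each statement's English description precedes it below -/
import Mathlib

section
/- For all n, h, k ≥ 1, the number of inversion sequences e of size n avoiding the patterns 210 and 100 with top(e) − bottom(e) = h and n − top(e) = k equals the number of semi-Baxter permutations of size n with label (h,k). (Refined form of Theorem 3.7: the growth of inversion sequences in I_n(210,100) by addition of a rightmost entry is encoded by the succession rule Ω_semi.) -/
/-- `f` contains the vincular pattern 2-41-3: there are positions
`i < j` and `k > j+1` with `f (j+1) < f i < f k < f j`. -/
def Contains2413 {m : ℕ} (f : Fin m → Fin m) : Prop :=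
  ∃ i j j' k : Fin m, (i : ℕ) < (j : ℕ) ∧ (j' : ℕ) = (j : ℕ) + 1 ∧ (j' : ℕ) < (k : ℕ) ∧
    f j' < f i ∧ f i < f k ∧ f k < f j

/-- A semi-Baxter permutation avoids 2-41-3. -/
def IsSemiBaxter {n : ℕ} (π : Equiv.Perm (Fin n)) : Prop := ¬ Contains2413 ⇑π

/-- The local expansion `π · a` on the right of `π` (with 0-indexed values):
the last entry is `a`, and the entry at position `i < n` is `π i` if `π i < a`,
and `π i + 1` otherwise. -/
def insertFun {n : ℕ} (π : Equiv.Perm (Fin n)) (a : Fin (n + 1)) :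
    Fin (n + 1) → Fin (n + 1) := fun i =>
  if h : (i : ℕ) < n then
    (if ((π ⟨i, h⟩ : Fin n) : ℕ) < (a : ℕ)
      then ⟨((π ⟨i, h⟩ : Fin n) : ℕ), Nat.lt_succ_of_lt (π ⟨i, h⟩).isLt⟩
      else ⟨((π ⟨i, h⟩ : Fin n) : ℕ) + 1, Nat.succ_lt_succ (π ⟨i, h⟩).isLt⟩)
  else a

/-- Number of semi-Baxter permutations of size `n` with label `(h, k)`, where `h`
(resp. `k`) is the number of active sites weakly below (resp. strictly above)
the last entry. -/
noncomputable def semiBaxterLabelCount (n h k : ℕ) : ℕ :=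
  Nat.card {π : Equiv.Perm (Fin n) // IsSemiBaxter π ∧
    ∃ hn : 0 < n,
      h = Nat.card {a : Fin (n + 1) // ¬ Contains2413 (insertFun π a) ∧
            (a : ℕ) ≤ ((π ⟨n - 1, Nat.sub_lt hn Nat.one_pos⟩ : Fin n) : ℕ)} ∧
      k = Nat.card {a : Fin (n + 1) // ¬ Contains2413 (insertFun π a) ∧
            ((π ⟨n - 1, Nat.sub_lt hn Nat.one_pos⟩ : Fin n) : ℕ) < (a : ℕ)}}

/-- An inversion sequence of size `n` (0-indexed): `e i ≤ i` for all `i`. -/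
def IsInvSeq {n : ℕ} (e : Fin n → ℕ) : Prop := ∀ i : Fin n, e i ≤ (i : ℕ)

/-- `e` contains the pattern 210. -/
def InvContains210 {n : ℕ} (e : Fin n → ℕ) : Prop :=
  ∃ i j k : Fin n, i < j ∧ j < k ∧ e j < e i ∧ e k < e j

/-- `e` contains the pattern 100. -/
def InvContains100 {n : ℕ} (e : Fin n → ℕ) : Prop :=
  ∃ i j k : Fin n, i < j ∧ j < k ∧ e j < e i ∧ e j = e k

/-- `top(e)`: the maximum of the weak left-to-right maxima of `e`,
equivalently the maximum entry of `e`. -/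
def topVal {n : ℕ} (e : Fin n → ℕ) : ℕ := Finset.univ.sup e

/-- `bottom(e)`: the maximum of the entries of `e` that are not weak
left-to-right maxima, with the convention `bottom(e) = -1` if every entry is a
weak left-to-right maximum. -/
def bottomVal {n : ℕ} (e : Fin n → ℕ) : ℤ :=
  ((Finset.univ.filter fun j : Fin n => ∃ i : Fin n, i < j ∧ e j < e i).sup
    fun j => e j + 1 : ℕ) - 1

/-- The succession rule `Ω_semi`: `SemiRule (h, k) c` says that a node labelled `(h, k)` has a
child labelled `c`. -/
def SemiRule (c c' : ℕ × ℕ) : Prop :=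
  (1 ≤ c'.1 ∧ c'.1 ≤ c.1 ∧ c'.2 = c.2 + 1) ∨
    (c.1 + 1 ≤ c'.1 ∧ 1 ≤ c'.2 ∧ c'.1 + c'.2 = c.1 + c.2 + 1)

/-- `X'` is the generation following `X` in a generating tree with succession rule `R`, in which
siblings have distinct labels. -/
def IsNextGeneration {X X' C : Type*} (R : C → C → Prop) (L : X → C) (L' : X' → C) : Prop :=
  ∃ p : X' → X, (∀ y z, p y = p z → L' y = L' z → y = z) ∧
    ∀ x c, (∃ y, p y = x ∧ L' y = c) ↔ R (L x) c

theorem IsNextGeneration.nonempty_equiv {X X' C : Type*} {R : C → C → Prop} {L : X → C}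
    {L' : X' → C} (H : IsNextGeneration R L L') (c : C) :
    Nonempty ({y // L' y = c} ≃ {x // R (L x) c}) := by
  obtain ⟨p, hinj, himg⟩ := H
  refine ⟨Equiv.ofBijective (fun y => ⟨p y.1, (himg _ _).1 ⟨y.1, rfl, y.2⟩⟩) ⟨?_, ?_⟩⟩
  · rintro ⟨y, hy⟩ ⟨z, hz⟩ h
    exact Subtype.ext (hinj y z (congrArg Subtype.val h) (hy.trans hz.symm))
  · rintro ⟨x, hx⟩
    obtain ⟨y, hy, hc⟩ := (himg x c).2 hx
    exact ⟨⟨y, hc⟩, Subtype.ext hy⟩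

theorem IsNextGeneration.exists_equiv {X X' Y Y' C : Type*} {R : C → C → Prop} {L : X → C}
    {L' : X' → C} {M : Y → C} {M' : Y' → C} (H : IsNextGeneration R L L')
    (K : IsNextGeneration R M M') (h : ∃ e : X ≃ Y, ∀ x, M (e x) = L x) :
    ∃ e : X' ≃ Y', ∀ x, M' (e x) = L' x := by
  obtain ⟨e, he⟩ := h
  have key (c : C) : Nonempty ({x // L' x = c} ≃ {y // M' y = c}) := by
    obtain ⟨f⟩ := H.nonempty_equiv c
    obtain ⟨g⟩ := K.nonempty_equiv c
    exact ⟨f.trans ((e.subtypeEquiv fun x => by rw [he]).trans g.symm)⟩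
  have f (c : C) := (key c).some
  refine ⟨(Equiv.sigmaFiberEquiv L').symm.trans
    ((Equiv.sigmaCongrRight f).trans (Equiv.sigmaFiberEquiv M')), fun x => ?_⟩
  exact (f (L' x) ⟨x, rfl⟩).2

/-! ### Inversion sequences -/

/-- Inversion sequences avoiding 210 and 100. -/
def IsGoodInvSeq {n : ℕ} (e : Fin n → ℕ) : Prop :=
  IsInvSeq e ∧ ¬ InvContains210 e ∧ ¬ InvContains100 e

/-- `bottom(e) + 1` as a natural number. -/
def bottomSucc {n : ℕ} (e : Fin n → ℕ) : ℕ :=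
  (Finset.univ.filter fun j : Fin n => ∃ i : Fin n, i < j ∧ e j < e i).sup fun j => e j + 1

/-- The label `(top(e) − bottom(e), n − top(e))`. -/
def invSeqLabel {n : ℕ} (e : Fin n → ℕ) : ℕ × ℕ :=
  (topVal e + 1 - bottomSucc e, n - topVal e)

theorem topVal_le_iff {n : ℕ} (e : Fin n → ℕ) (m : ℕ) : topVal e ≤ m ↔ ∀ i, e i ≤ m := by
  simp [topVal]

theorem bottomSucc_le_iff {n : ℕ} (e : Fin n → ℕ) (m : ℕ) :
    bottomSucc e ≤ m ↔ ∀ i j, i < j → e j < e i → e j < m := by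
  simp only [bottomSucc, Finset.sup_le_iff, Finset.mem_filter, Finset.mem_univ, true_and,
    Nat.succ_le_iff]
  exact ⟨fun h i j hij hlt => h j ⟨i, hij, hlt⟩, fun h j ⟨i, hij, hlt⟩ => h i j hij hlt⟩

theorem bottomSucc_le_topVal {n : ℕ} (e : Fin n → ℕ) : bottomSucc e ≤ topVal e :=
  (bottomSucc_le_iff _ _).2 fun i _ _ h => h.trans_le ((topVal_le_iff e _).1 le_rfl i)

theorem IsInvSeq.topVal_le {n : ℕ} {e : Fin (n + 1) → ℕ} (h : IsInvSeq e) : topVal e ≤ n :=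
  (topVal_le_iff _ _).2 fun i => (h i).trans (Nat.lt_succ_iff.1 i.2)

theorem topVal_snoc {n : ℕ} (e : Fin n → ℕ) (x : ℕ) :
    topVal (Fin.snoc e x : Fin (n + 1) → ℕ) = max (topVal e) x := by
  refine eq_of_forall_ge_iff fun m => ?_
  simp [topVal_le_iff, Fin.forall_fin_succ']

theorem bottomSucc_snoc {n : ℕ} (e : Fin n → ℕ) (x : ℕ) :
    bottomSucc (Fin.snoc e x : Fin (n + 1) → ℕ) =
      if x < topVal e then max (bottomSucc e) (x + 1) else bottomSucc e := by
  refine eq_of_forall_ge_iff fun m => ?_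
  have hx : (∀ i, x < e i → x < m) ↔ (x < topVal e → x < m) := by
    rw [lt_iff_not_ge (a := x) (b := topVal e), topVal_le_iff]
    simp only [not_forall, not_le]
    exact ⟨fun h ⟨i, hi⟩ => h i hi, fun h i hi => h ⟨i, hi⟩⟩
  have : bottomSucc (Fin.snoc e x : Fin (n + 1) → ℕ) ≤ m ↔
      bottomSucc e ≤ m ∧ (x < topVal e → x < m) := by
    rw [← hx]
    simp only [bottomSucc_le_iff, Fin.forall_fin_succ', Fin.snoc_castSucc, Fin.snoc_last,
      Fin.castSucc_lt_castSucc_iff, Fin.castSucc_lt_last, lt_irrefl, forall_true_left]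
    have hlast (i : Fin n) : ¬ Fin.last n < i.castSucc := (Fin.castSucc_lt_last i).not_gt
    simp only [hlast, false_imp_iff, implies_true, and_true]
    exact forall_and
  rw [this]
  split_ifs with h <;> simp [h]

theorem isInvSeq_snoc {n : ℕ} (e : Fin n → ℕ) (x : ℕ) :
    IsInvSeq (Fin.snoc e x : Fin (n + 1) → ℕ) ↔ IsInvSeq e ∧ x ≤ n := by
  simp [IsInvSeq, Fin.forall_fin_succ']

theorem avoids_iff {n : ℕ} (e : Fin n → ℕ) :
    (¬ InvContains210 e ∧ ¬ InvContains100 e) ↔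
      ∀ k i j, i < j → j < k → e j < e i → e j < e k := by
  constructor
  · rintro ⟨h1, h2⟩ k i j hij hjk hlt
    by_contra hle
    rcases (not_lt.1 hle).lt_or_eq with h | h
    · exact h1 ⟨i, j, k, hij, hjk, hlt, h⟩
    · exact h2 ⟨i, j, k, hij, hjk, hlt, h.symm⟩
  · intro h
    constructor
    · rintro ⟨i, j, k, hij, hjk, hlt, h'⟩
      exact (h k i j hij hjk hlt).not_gt h'
    · rintro ⟨i, j, k, hij, hjk, hlt, h'⟩
      exact (h k i j hij hjk hlt).ne h'

theorem avoids_snoc {n : ℕ} (e : Fin n → ℕ) (x : ℕ) :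
    (¬ InvContains210 (Fin.snoc e x : Fin (n + 1) → ℕ) ∧
      ¬ InvContains100 (Fin.snoc e x : Fin (n + 1) → ℕ)) ↔
      (¬ InvContains210 e ∧ ¬ InvContains100 e) ∧ bottomSucc e ≤ x := by
  have hlast (i : Fin n) : ¬ Fin.last n < i.castSucc := (Fin.castSucc_lt_last i).not_gt
  simp only [avoids_iff, bottomSucc_le_iff, Fin.forall_fin_succ', Fin.snoc_castSucc,
    Fin.snoc_last, Fin.castSucc_lt_castSucc_iff, Fin.castSucc_lt_last, lt_irrefl, hlast,
    forall_true_left, false_imp_iff, implies_true, and_true]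

theorem isGoodInvSeq_snoc {n : ℕ} (e : Fin n → ℕ) (x : ℕ) :
    IsGoodInvSeq (Fin.snoc e x : Fin (n + 1) → ℕ) ↔
      IsGoodInvSeq e ∧ bottomSucc e ≤ x ∧ x ≤ n := by
  rw [IsGoodInvSeq, avoids_snoc, isInvSeq_snoc, IsGoodInvSeq]
  tauto

theorem isNextGeneration_invSeq (n : ℕ) :
    IsNextGeneration SemiRule
      (fun e : {e : Fin (n + 1) → ℕ // IsGoodInvSeq e} => invSeqLabel e.1)
      (fun e : {e : Fin (n + 2) → ℕ // IsGoodInvSeq e} => invSeqLabel e.1) := by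
  have hp (e : Fin (n + 2) → ℕ) (he : IsGoodInvSeq e) :
      IsGoodInvSeq (Fin.init e : Fin (n + 1) → ℕ) := by
    rw [← Fin.snoc_init_self e] at he
    exact ((isGoodInvSeq_snoc _ _).1 he).1
  refine ⟨fun e => ⟨Fin.init e.1, hp e.1 e.2⟩, ?_, ?_⟩
  · rintro ⟨y, hy⟩ ⟨z, hz⟩ hyz hL
    have hyz' : (Fin.init y : Fin (n + 1) → ℕ) = Fin.init z := congrArg Subtype.val hyz
    refine Subtype.ext ?_
    change y = z
    dsimp only at hL
    rw [← Fin.snoc_init_self y] at hy hL ⊢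
    rw [← Fin.snoc_init_self z] at hz hL ⊢
    rw [hyz'] at hy hL ⊢
    generalize (Fin.init z : Fin (n + 1) → ℕ) = e at *
    generalize y (Fin.last (n + 1)) = a at *
    generalize z (Fin.last (n + 1)) = b at *
    rw [isGoodInvSeq_snoc] at hy hz
    have h1 := bottomSucc_le_topVal e
    have h2 := hy.1.1.topVal_le
    suffices a = b by rw [this]
    simp only [invSeqLabel, topVal_snoc, bottomSucc_snoc, Prod.mk.injEq] at hL
    obtain ⟨hL1, hL2⟩ := hL
    split_ifs at hL1 <;> omega
  · rintro ⟨e, he⟩ ⟨h, k⟩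
    have h1 := bottomSucc_le_topVal e
    have h2 := he.1.topVal_le
    constructor
    · rintro ⟨⟨y, hy⟩, hye, hL⟩
      have hye' : (Fin.init y : Fin (n + 1) → ℕ) = e := congrArg Subtype.val hye
      dsimp only at hL
      rw [← Fin.snoc_init_self y, hye'] at hy hL
      rw [isGoodInvSeq_snoc] at hy
      simp only [invSeqLabel, topVal_snoc, bottomSucc_snoc, Prod.mk.injEq] at hL
      simp only [SemiRule, invSeqLabel]
      obtain ⟨hL1, hL2⟩ := hL
      split_ifs at hL1 <;> omega
    · intro hR
      simp only [SemiRule, invSeqLabel] at hR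
      obtain ⟨x, hx1, hx2, hx3⟩ : ∃ x, bottomSucc e ≤ x ∧ x ≤ n + 1 ∧
          invSeqLabel (Fin.snoc e x : Fin (n + 2) → ℕ) = (h, k) := by
        simp only [invSeqLabel, topVal_snoc, bottomSucc_snoc, Prod.mk.injEq]
        rcases hR with ⟨h3, h4, h5⟩ | ⟨h3, h4, h5⟩
        · by_cases hh : h = topVal e + 1 - bottomSucc e
          · exact ⟨topVal e, by omega, by omega, by split_ifs <;> omega, by omega⟩
          · exact ⟨topVal e - h, by omega, by omega, by split_ifs <;> omega, by omega⟩
        · exact ⟨n + 2 - k, by omega, by omega, by split_ifs <;> omega, by omega⟩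
      exact ⟨⟨Fin.snoc e x, (isGoodInvSeq_snoc e x).2 ⟨he, hx1, hx2⟩⟩,
        Subtype.ext (Fin.init_snoc (α := fun _ => ℕ) x e), hx3⟩

/-! ### Semi-Baxter permutations -/

theorem exists_castSucc_eq {n : ℕ} {i : Fin (n + 1)} (h : (i : ℕ) < n) :
    ∃ j : Fin n, j.castSucc = i :=
  ⟨⟨i, h⟩, rfl⟩

theorem insertFun_castSucc {n : ℕ} (π : Equiv.Perm (Fin n)) (a : Fin (n + 1)) (i : Fin n) :
    (insertFun π a i.castSucc : ℕ) = if (π i : ℕ) < a then (π i : ℕ) else π i + 1 := by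
  simp only [insertFun, Fin.val_castSucc, i.isLt, dite_true, Fin.eta]
  split_ifs <;> rfl

theorem insertFun_last {n : ℕ} (π : Equiv.Perm (Fin n)) (a : Fin (n + 1)) :
    insertFun π a (Fin.last n) = a := by
  simp [insertFun]

theorem insertFun_injective {n : ℕ} (π : Equiv.Perm (Fin n)) (a : Fin (n + 1)) :
    Function.Injective (insertFun π a) := by
  intro i j hij
  have hval := congrArg Fin.val hij
  induction i using Fin.lastCases with
  | last =>
    induction j using Fin.lastCases with
    | last => rfl
    | cast j =>
      rw [insertFun_last, insertFun_castSucc] at hval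
      split_ifs at hval <;> omega
  | cast i =>
    induction j using Fin.lastCases with
    | last =>
      rw [insertFun_last, insertFun_castSucc] at hval
      split_ifs at hval <;> omega
    | cast j =>
      rw [insertFun_castSucc, insertFun_castSucc] at hval
      congr 1
      apply π.injective
      apply Fin.ext
      split_ifs at hval <;> omega

/-- `insertFun π a` as a permutation. -/
noncomputable def insertPerm {n : ℕ} (π : Equiv.Perm (Fin n)) (a : Fin (n + 1)) :
    Equiv.Perm (Fin (n + 1)) :=
  Equiv.ofBijective (insertFun π a) (Finite.injective_iff_bijective.1 (insertFun_injective π a))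

theorem coe_insertPerm {n : ℕ} (π : Equiv.Perm (Fin n)) (a : Fin (n + 1)) :
    ⇑(insertPerm π a) = insertFun π a := rfl

theorem insertPerm_bijective (n : ℕ) :
    Function.Bijective fun x : Equiv.Perm (Fin n) × Fin (n + 1) => insertPerm x.1 x.2 := by
  rw [Fintype.bijective_iff_injective_and_card]
  constructor
  · rintro ⟨π, a⟩ ⟨σ, b⟩ h
    have hfun : insertFun π a = insertFun σ b := congrArg DFunLike.coe h
    have hab : a = b := by
      simpa only [insertFun_last] using congrFun hfun (Fin.last n)
    subst hab
    have : π = σ := by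
      ext i
      have := congrArg Fin.val (congrFun hfun i.castSucc)
      rw [insertFun_castSucc, insertFun_castSucc] at this
      split_ifs at this <;> omega
    rw [this]
  · simp [Fintype.card_perm, Nat.factorial_succ, mul_comm]

/-- The site `s` of `π` is blocked if inserting `s` on the right creates an occurrence of
2-41-3 ending in the new entry. -/
def Blocked {n : ℕ} (π : Equiv.Perm (Fin n)) (s : ℕ) : Prop :=
  ∃ i j j' : Fin n, (i : ℕ) < j ∧ (j' : ℕ) = j + 1 ∧
    (π j' : ℕ) < π i ∧ (π i : ℕ) < s ∧ s ≤ π j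

theorem contains2413_insertFun {n : ℕ} (π : Equiv.Perm (Fin n)) (a : Fin (n + 1)) :
    Contains2413 (insertFun π a) ↔ Contains2413 π ∨ Blocked π a := by
  constructor
  · rintro ⟨i, j, j', k, hij, hj, hk, h1, h2, h3⟩
    have hkn := k.isLt
    obtain ⟨i, rfl⟩ := exists_castSucc_eq (i := i) (by omega)
    obtain ⟨j, rfl⟩ := exists_castSucc_eq (i := j) (by omega)
    obtain ⟨j', rfl⟩ := exists_castSucc_eq (i := j') (by omega)
    simp only [Fin.lt_def, insertFun_castSucc] at h1 h2 h3
    simp only [Fin.val_castSucc] at hij hj hk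
    induction k using Fin.lastCases with
    | last =>
      rw [insertFun_last] at h2 h3
      refine Or.inr ⟨i, j, j', hij, hj, ?_, ?_, ?_⟩ <;> split_ifs at * <;> omega
    | cast k =>
      rw [insertFun_castSucc] at h2 h3
      refine Or.inl ⟨i, j, j', k, hij, hj, hk, ?_, ?_, ?_⟩ <;> rw [Fin.lt_def] <;>
        split_ifs at * <;> omega
  · rintro (⟨i, j, j', k, hij, hj, hk, h1, h2, h3⟩ | ⟨i, j, j', hij, hj, h1, h2, h3⟩)
    · refine ⟨i.castSucc, j.castSucc, j'.castSucc, k.castSucc, hij, hj, hk, ?_, ?_, ?_⟩ <;>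
        simp only [Fin.lt_def, insertFun_castSucc] at * <;> split_ifs <;> omega
    · refine ⟨i.castSucc, j.castSucc, j'.castSucc, Fin.last n, hij, hj, j'.isLt, ?_, ?_, ?_⟩ <;>
        simp only [Fin.lt_def, insertFun_castSucc, insertFun_last] at * <;> split_ifs <;> omega

theorem isSemiBaxter_insertPerm {n : ℕ} (π : Equiv.Perm (Fin n)) (a : Fin (n + 1)) :
    IsSemiBaxter (insertPerm π a) ↔ IsSemiBaxter π ∧ ¬ Blocked π a := by
  rw [IsSemiBaxter, coe_insertPerm, contains2413_insertFun, not_or, IsSemiBaxter]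

theorem blocked_insertPerm {n : ℕ} (π : Equiv.Perm (Fin (n + 1))) (a : Fin (n + 2)) (s : ℕ) :
    Blocked (insertPerm π a) s ↔ Blocked π (if s ≤ a then s else s - 1) ∨
      ((a : ℕ) ≤ π (Fin.last n) ∧ (a : ℕ) + 2 ≤ s ∧ s ≤ π (Fin.last n) + 1) := by
  simp only [Blocked, coe_insertPerm]
  constructor
  · rintro ⟨i, j, j', hij, hj, h1, h2, h3⟩
    have hjn := j'.isLt
    obtain ⟨i, rfl⟩ := exists_castSucc_eq (i := i) (by omega)
    obtain ⟨j, rfl⟩ := exists_castSucc_eq (i := j) (by omega)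
    simp only [insertFun_castSucc] at h1 h2 h3
    simp only [Fin.val_castSucc] at hij hj
    induction j' using Fin.lastCases with
    | last =>
      obtain rfl : j = Fin.last n := Fin.ext (by simp only [Fin.val_last] at *; omega)
      rw [insertFun_last] at h1
      right
      split_ifs at * <;> omega
    | cast j' =>
      rw [insertFun_castSucc] at h1
      refine Or.inl ⟨i, j, j', hij, hj, ?_, ?_, ?_⟩ <;> split_ifs at * <;> omega
  · rintro (⟨i, j, j', hij, hj, h1, h2, h3⟩ | ⟨h1, h2, h3⟩)
    · refine ⟨i.castSucc, j.castSucc, j'.castSucc, hij, hj, ?_, ?_, ?_⟩ <;>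
        simp only [insertFun_castSucc] <;> split_ifs at * <;> omega
    · have hlast := (π (Fin.last n)).isLt
      have hi : (π (π.symm ⟨a, by omega⟩) : ℕ) = a := by rw [Equiv.apply_symm_apply]
      generalize π.symm ⟨a, by omega⟩ = i at hi
      have hne : i ≠ Fin.last n := by
        rintro rfl
        omega
      refine ⟨i.castSucc, (Fin.last n).castSucc, Fin.last (n + 1), ?_, rfl, ?_, ?_, ?_⟩
      · exact Fin.lt_def.1 (Fin.lt_last_iff_ne_last.2 hne)
      all_goals
        simp only [insertFun_castSucc, insertFun_last]
        split_ifs <;> omega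

open Classical in
/-- The number of active (i.e. not blocked) sites of `π` smaller than `m`. -/
noncomputable def activeCount {n : ℕ} (π : Equiv.Perm (Fin n)) (m : ℕ) : ℕ :=
  Nat.count (fun s => ¬ Blocked π s) m

/-- The label of a semi-Baxter permutation. -/
noncomputable def semiBaxterLabel {n : ℕ} (π : Equiv.Perm (Fin (n + 1))) : ℕ × ℕ :=
  (activeCount π (π (Fin.last n) + 1),
    activeCount π (n + 2) - activeCount π (π (Fin.last n) + 1))

theorem activeCount_mono {n : ℕ} (π : Equiv.Perm (Fin n)) {l m : ℕ} (h : l ≤ m) :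
    activeCount π l ≤ activeCount π m := by
  classical exact Nat.count_monotone _ h

open Classical in
theorem activeCount_succ {n : ℕ} (π : Equiv.Perm (Fin n)) (m : ℕ) :
    activeCount π (m + 1) = activeCount π m + if Blocked π m then 0 else 1 := by
  rw [activeCount, Nat.count_succ, activeCount]
  split_ifs <;> simp_all

theorem activeCount_succ_of_not_blocked {n : ℕ} {π : Equiv.Perm (Fin n)} {m : ℕ}
    (h : ¬ Blocked π m) : activeCount π (m + 1) = activeCount π m + 1 := by
  rw [activeCount_succ, if_neg h]

theorem activeCount_injective {n : ℕ} {π : Equiv.Perm (Fin n)} {a b : ℕ} (ha : ¬ Blocked π a)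
    (hb : ¬ Blocked π b) (h : activeCount π a = activeCount π b) : a = b := by
  classical exact Nat.count_injective ha hb h

theorem exists_activeCount_eq {n : ℕ} {π : Equiv.Perm (Fin n)} {r m : ℕ}
    (h : r < activeCount π m) : ∃ a < m, ¬ Blocked π a ∧ activeCount π a = r := by
  induction m with
  | zero => simp [activeCount] at h
  | succ m ih =>
    by_cases hr : r < activeCount π m
    · obtain ⟨a, ha, h'⟩ := ih hr
      exact ⟨a, ha.trans (Nat.lt_succ_self m), h'⟩
    · rw [activeCount_succ] at h
      split_ifs at h with hb
      · omega
      · exact ⟨m, Nat.lt_succ_self m, hb, by omega⟩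

theorem activeCount_insertPerm_of_le {n : ℕ} (π : Equiv.Perm (Fin (n + 1))) (a : Fin (n + 2))
    {m : ℕ} (hm : m ≤ a + 1) : activeCount (insertPerm π a) m = activeCount π m := by
  classical
  induction m with
  | zero => simp [activeCount]
  | succ m ih =>
    have : Blocked (insertPerm π a) m ↔ Blocked π m := by
      rw [blocked_insertPerm, if_pos (by omega)]
      exact or_iff_left (by omega)
    rw [activeCount_succ, activeCount_succ, ih (by omega)]
    rw [if_congr this rfl rfl]

theorem activeCount_insertPerm_of_last_lt {n : ℕ} {π : Equiv.Perm (Fin (n + 1))}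
    {a : Fin (n + 2)} (ha : ¬ Blocked π a) (h : (π (Fin.last n) : ℕ) < a) {m : ℕ}
    (hm : (a : ℕ) + 1 ≤ m) : activeCount (insertPerm π a) (m + 1) = activeCount π m + 1 := by
  classical
  have hb (s : ℕ) (hs : (a : ℕ) + 1 ≤ s) :
      Blocked (insertPerm π a) s ↔ Blocked π (s - 1) := by
    rw [blocked_insertPerm, if_neg (by omega)]
    exact or_iff_left (by omega)
  induction m, hm using Nat.le_induction with
  | base =>
    rw [activeCount_succ, activeCount_insertPerm_of_le π a le_rfl, if_neg]
    rw [hb _ le_rfl]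
    exact ha
  | succ m hm ih =>
    rw [activeCount_succ, ih, activeCount_succ π]
    rw [if_congr (hb (m + 1) (by omega)) rfl rfl, Nat.add_sub_cancel]
    omega

theorem activeCount_insertPerm_of_le_last {n : ℕ} {π : Equiv.Perm (Fin (n + 1))}
    {a : Fin (n + 2)} (ha : ¬ Blocked π a) (h : (a : ℕ) ≤ π (Fin.last n)) {m : ℕ}
    (hm : (π (Fin.last n) : ℕ) + 1 ≤ m) :
    activeCount (insertPerm π a) (m + 1) + activeCount π (π (Fin.last n) + 1) =
      activeCount π m + activeCount π a + 2 := by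
  classical
  have hmid {l : ℕ} (hl : (a : ℕ) + 1 ≤ l) (hl' : l ≤ π (Fin.last n) + 1) :
      activeCount (insertPerm π a) (l + 1) = activeCount π a + 2 := by
    induction l, hl using Nat.le_induction with
    | base =>
      rw [activeCount_succ, activeCount_insertPerm_of_le π a le_rfl,
        activeCount_succ_of_not_blocked ha, if_neg]
      rw [blocked_insertPerm, if_neg (by omega)]
      rintro (h' | h')
      · exact ha h'
      · omega
    | succ l hl ih =>
      rw [activeCount_succ, ih (by omega), if_pos]
      rw [blocked_insertPerm]
      exact Or.inr ⟨h, by omega, hl'⟩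
  induction m, hm using Nat.le_induction with
  | base => rw [hmid (by omega) le_rfl]; omega
  | succ m hm ih =>
    have hb : Blocked (insertPerm π a) (m + 1) ↔ Blocked π m := by
      rw [blocked_insertPerm, if_neg (by omega)]
      exact or_iff_left (by omega)
    rw [activeCount_succ, activeCount_succ π m, if_congr hb rfl rfl]
    omega

theorem semiBaxterLabel_insertPerm {n : ℕ} {π : Equiv.Perm (Fin (n + 1))} {a : Fin (n + 2)}
    (ha : ¬ Blocked π a) :
    semiBaxterLabel (insertPerm π a) =
      if (a : ℕ) ≤ π (Fin.last n) then (activeCount π a + 1, (semiBaxterLabel π).2 + 1)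
      else (activeCount π a + 1, activeCount π (n + 2) - activeCount π a) := by
  have hlast : insertPerm π a (Fin.last (n + 1)) = a := by rw [coe_insertPerm, insertFun_last]
  have hπ := (π (Fin.last n)).isLt
  have han := a.isLt
  simp only [semiBaxterLabel, hlast]
  rw [activeCount_insertPerm_of_le π a le_rfl, activeCount_succ_of_not_blocked ha]
  have hmono := activeCount_mono π (show (π (Fin.last n) : ℕ) + 1 ≤ n + 2 by omega)
  split_ifs with h
  · have := activeCount_insertPerm_of_le_last ha h (m := n + 2) (by omega)
    rw [show n + 1 + 2 = n + 2 + 1 from rfl]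
    simp only [Prod.mk.injEq, true_and]
    omega
  · rw [activeCount_insertPerm_of_last_lt ha (not_le.1 h) (m := n + 2) (by omega)]
    simp only [Prod.mk.injEq, true_and]
    omega

theorem isNextGeneration_semiBaxter (n : ℕ) :
    IsNextGeneration SemiRule
      (fun π : {π : Equiv.Perm (Fin (n + 1)) // IsSemiBaxter π} => semiBaxterLabel π.1)
      (fun π : {π : Equiv.Perm (Fin (n + 2)) // IsSemiBaxter π} => semiBaxterLabel π.1) := by
  let E := Equiv.ofBijective _ (insertPerm_bijective (n + 1))
  have hE (π : Equiv.Perm (Fin (n + 2))) :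
      insertPerm (E.symm π).1 (E.symm π).2 = π := E.apply_symm_apply π
  have hE' (π : Equiv.Perm (Fin (n + 1))) (a : Fin (n + 2)) :
      E.symm (insertPerm π a) = (π, a) := E.symm_apply_apply (π, a)
  have hp (σ : Equiv.Perm (Fin (n + 2))) (hσ : IsSemiBaxter σ) :
      IsSemiBaxter (E.symm σ).1 ∧ ¬ Blocked (E.symm σ).1 (E.symm σ).2 := by
    rw [← isSemiBaxter_insertPerm, hE]
    exact hσ
  refine ⟨fun σ => ⟨(E.symm σ.1).1, (hp σ.1 σ.2).1⟩, ?_, ?_⟩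
  · rintro ⟨y, hy⟩ ⟨z, hz⟩ hyz hL
    have hyz' : (E.symm y).1 = (E.symm z).1 := congrArg Subtype.val hyz
    have hy' := (hp y hy).2
    have hz' := (hp z hz).2
    dsimp only at hL
    rw [← hE y, ← hE z, semiBaxterLabel_insertPerm hy', semiBaxterLabel_insertPerm hz',
      hyz'] at hL
    rw [hyz'] at hy'
    have hcount : activeCount (E.symm z).1 (E.symm y).2 =
        activeCount (E.symm z).1 (E.symm z).2 := by
      have := congrArg Prod.fst hL
      split_ifs at this <;> simpa using this
    refine Subtype.ext (E.symm.injective (Prod.ext hyz' (Fin.ext ?_)))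
    exact activeCount_injective hy' hz' hcount
  · rintro ⟨π, hπ⟩ ⟨h, k⟩
    have hlast := (π (Fin.last n)).isLt
    constructor
    · rintro ⟨⟨y, hy⟩, hyπ, hL⟩
      obtain rfl : (E.symm y).1 = π := congrArg Subtype.val hyπ
      have hb := (hp y hy).2
      dsimp only at hL hlast ⊢
      rw [← hE y, semiBaxterLabel_insertPerm hb] at hL
      generalize (E.symm y).1 = π at *
      generalize (E.symm y).2 = a at *
      have ha := a.isLt
      have h1 := activeCount_succ_of_not_blocked hb
      have h2 := activeCount_mono π (show (a : ℕ) + 1 ≤ n + 2 by omega)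
      have h3 := activeCount_mono π (show (π (Fin.last n) : ℕ) + 1 ≤ n + 2 by omega)
      simp only [SemiRule, semiBaxterLabel] at hL ⊢
      split_ifs at hL with hle
      · have h4 := activeCount_mono π (show (a : ℕ) + 1 ≤ π (Fin.last n) + 1 by omega)
        simp only [Prod.mk.injEq] at hL
        omega
      · have h4 := activeCount_mono π (show (π (Fin.last n) : ℕ) + 1 ≤ a by omega)
        simp only [Prod.mk.injEq] at hL
        omega
    · intro hR
      simp only [SemiRule, semiBaxterLabel] at hR
      have h3 := activeCount_mono π (show (π (Fin.last n) : ℕ) + 1 ≤ n + 2 by omega)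
      obtain ⟨a, ha, hb, hc⟩ := exists_activeCount_eq (π := π) (r := h - 1) (m := n + 2) (by omega)
      have h1 := activeCount_succ_of_not_blocked hb
      refine ⟨⟨insertPerm π ⟨a, ha⟩, (isSemiBaxter_insertPerm _ _).2 ⟨hπ, hb⟩⟩,
        Subtype.ext (by simp only [hE']), ?_⟩
      dsimp only
      rw [semiBaxterLabel_insertPerm (a := ⟨a, ha⟩) hb]
      simp only [semiBaxterLabel]
      split_ifs with hle
      · have h4 := activeCount_mono π (show a + 1 ≤ π (Fin.last n) + 1 by omega)
        simp only [Prod.mk.injEq]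
        omega
      · have h4 := activeCount_mono π (show (π (Fin.last n) : ℕ) + 1 ≤ a by omega)
        simp only [Prod.mk.injEq]
        omega

theorem exists_equiv_label (n : ℕ) :
    ∃ f : {e : Fin (n + 1) → ℕ // IsGoodInvSeq e} ≃
        {π : Equiv.Perm (Fin (n + 1)) // IsSemiBaxter π},
      ∀ e, semiBaxterLabel (f e).1 = invSeqLabel e.1 := by
  induction n with
  | zero =>
    have hblocked (π : Equiv.Perm (Fin 1)) (s : ℕ) : ¬ Blocked π s := by
      rintro ⟨i, j, j', hij, -⟩
      omega
    have hpi (e : Fin 1 → ℕ) (he : IsGoodInvSeq e) : e = 0 := by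
      funext i
      have := he.1 i
      simp only [Pi.zero_apply]
      omega
    have hgood : IsGoodInvSeq (0 : Fin 1 → ℕ) := by
      refine ⟨fun i => Nat.zero_le _, ?_, ?_⟩ <;> rintro ⟨i, j, k, hij, -⟩ <;> omega
    have hsemi : IsSemiBaxter (1 : Equiv.Perm (Fin 1)) := by
      rintro ⟨i, j, j', k, hij, -⟩
      omega
    let _ : Unique {e : Fin (0 + 1) → ℕ // IsGoodInvSeq e} :=
      ⟨⟨⟨0, hgood⟩⟩, fun e => Subtype.ext (hpi e.1 e.2)⟩
    let _ : Unique {π : Equiv.Perm (Fin (0 + 1)) // IsSemiBaxter π} :=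
      ⟨⟨⟨1, hsemi⟩⟩, fun π => Subtype.ext (Subsingleton.elim (α := Equiv.Perm (Fin 1)) _ _)⟩
    refine ⟨Equiv.ofUnique _ _, fun e => ?_⟩
    rw [Unique.eq_default e]
    have hcount (π : Equiv.Perm (Fin 1)) (m : ℕ) : activeCount π m = m := by
      induction m with
      | zero => simp [activeCount]
      | succ m ih => rw [activeCount_succ, ih, if_neg (hblocked π m)]
    have hlabel (π : Equiv.Perm (Fin 1)) : semiBaxterLabel π = (1, 1) := by
      have := (π (Fin.last 0)).isLt
      simp only [semiBaxterLabel, hcount, Prod.mk.injEq]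
      omega
    refine (hlabel _).trans ?_
    have htop : topVal (0 : Fin 1 → ℕ) = 0 := by simp [topVal]
    have hbot := bottomSucc_le_topVal (0 : Fin 1 → ℕ)
    change (1, 1) = invSeqLabel (0 : Fin 1 → ℕ)
    simp only [invSeqLabel, Prod.mk.injEq]
    omega
  | succ n ih => exact (isNextGeneration_invSeq n).exists_equiv (isNextGeneration_semiBaxter n) ih

theorem natCard_active_lt {n : ℕ} {π : Equiv.Perm (Fin n)} (hπ : IsSemiBaxter π) {m : ℕ}
    (hm : m ≤ n + 1) :
    Nat.card {a : Fin (n + 1) // ¬ Contains2413 (insertFun π a) ∧ (a : ℕ) < m} =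
      activeCount π m := by
  classical
  have hC (a : Fin (n + 1)) : Contains2413 (insertFun π a) ↔ Blocked π a := by
    rw [contains2413_insertFun]
    exact or_iff_right hπ
  rw [activeCount, Nat.count_eq_card_fintype, Fintype.card_eq_nat_card]
  exact Nat.card_congr
    { toFun := fun a => ⟨a.1, a.2.2, (hC a.1).not.1 a.2.1⟩
      invFun := fun k => ⟨⟨k.1, k.2.1.trans_le hm⟩, (hC _).not.2 k.2.2, k.2.1⟩
      left_inv := fun _ => rfl
      right_inv := fun _ => rfl }

theorem natCard_active_ge {n : ℕ} {π : Equiv.Perm (Fin n)} (hπ : IsSemiBaxter π) {m : ℕ}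
    (hm : m ≤ n + 1) :
    Nat.card {a : Fin (n + 1) // ¬ Contains2413 (insertFun π a) ∧ m ≤ (a : ℕ)} =
      activeCount π (n + 1) - activeCount π m := by
  classical
  rw [← natCard_active_lt hπ hm, ← natCard_active_lt hπ le_rfl]
  simp only [Nat.card_eq_fintype_card, Fintype.card_subtype, Fin.is_lt, and_true]
  rw [← Finset.card_filter_add_card_filter_not (s := Finset.univ.filter fun a : Fin (n + 1) =>
    ¬ Contains2413 (insertFun π a)) (fun a => (a : ℕ) < m)]
  simp only [Finset.filter_filter, not_lt, Nat.add_sub_cancel_left]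

theorem semiBaxterLabelCount_succ (n h k : ℕ) :
    semiBaxterLabelCount (n + 1) h k =
      Nat.card {π : {π : Equiv.Perm (Fin (n + 1)) // IsSemiBaxter π} //
        semiBaxterLabel π.1 = (h, k)} := by
  refine Nat.card_congr ((Equiv.subtypeEquivRight fun π => ?_).trans
    (Equiv.subtypeSubtypeEquivSubtypeInter IsSemiBaxter fun π => semiBaxterLabel π = (h, k)).symm)
  refine and_congr_right fun hπ => ?_
  have hlast : (⟨n + 1 - 1, Nat.sub_lt n.succ_pos Nat.one_pos⟩ : Fin (n + 1)) = Fin.last n := rfl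
  have hm : (π (Fin.last n) : ℕ) + 1 ≤ n + 1 + 1 := by omega
  have h1 := natCard_active_lt hπ hm
  have h2 := natCard_active_ge hπ hm
  simp only [Nat.lt_succ_iff, Nat.succ_le_iff] at h1 h2
  rw [exists_prop_of_true n.succ_pos, hlast, h1, h2, semiBaxterLabel, Prod.mk.injEq, eq_comm,
    @eq_comm _ k]

/-- Refined form of Theorem 3.7: inversion sequences in `I_n(210,100)` with
`top(e) − bottom(e) = h` and `n − top(e) = k` are equinumerous with semi-Baxter
permutations of size `n` with label `(h,k)`. -/
theorem invSeq_label_eq_semiBaxter_label (n h k : ℕ) (hn : 1 ≤ n) (hh : 1 ≤ h) (hk : 1 ≤ k) :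
    Nat.card {e : Fin n → ℕ // IsInvSeq e ∧ ¬ InvContains210 e ∧ ¬ InvContains100 e ∧
        (h : ℤ) = (topVal e : ℤ) - bottomVal e ∧ (k : ℤ) = (n : ℤ) - (topVal e : ℤ)} =
      semiBaxterLabelCount n h k := by
  obtain ⟨n, rfl⟩ : ∃ m, n = m + 1 := ⟨n - 1, by omega⟩
  obtain ⟨f, hf⟩ := exists_equiv_label n
  rw [semiBaxterLabelCount_succ]
  refine Nat.card_congr (((Equiv.subtypeEquivRight fun e => ?_).trans
    (Equiv.subtypeSubtypeEquivSubtypeInter IsGoodInvSeq fun e => invSeqLabel e = (h, k)).symm).trans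
      (f.subtypeEquiv fun e => by rw [hf]))
  have hbot : bottomVal e = (bottomSucc e : ℤ) - 1 := rfl
  have hle := bottomSucc_le_topVal e
  rw [hbot, IsGoodInvSeq, invSeqLabel, Prod.mk.injEq]
  constructor
  · rintro ⟨h1, h2, h3, h4, h5⟩
    exact ⟨⟨h1, h2, h3⟩, by omega, by omega⟩
  · rintro ⟨⟨h1, h2, h3⟩, h4, h5⟩
    exact ⟨h1, h2, h3, by omega, by omega⟩
end

section
/- For n, h, k ≥ 1, let t(n,h,k) denote the number of twisted Baxter permutations of size n with label (h,k). Then t(1,1,1) = 1 and t(1,h,k) = 0 for (h,k) ≠ (1,1), and for all n ≥ 1 and all h, k ≥ 1: t(n+1, h, k) = Σ_{h' > h} t(n, h', k) + t(n, h, k−1) + Σ_{m=1}^{h−1} t(n, m, h+k−1−m), where t(n, ·, 0) is interpreted as 0. (This is the recurrence on label counts encoded by the succession rule Ω_TBax of Proposition 4.2, under which the label (h,k) produces the labels (1,k),…,(h−1,k),(h,k+1) and (h+k,1),…,(h+1,k).) -/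
/-- `f` contains the vincular pattern 3-41-2. -/
def Contains3412 {m : ℕ} (f : Fin m → Fin m) : Prop :=
  ∃ i j j' k : Fin m, (i : ℕ) < (j : ℕ) ∧ (j' : ℕ) = (j : ℕ) + 1 ∧ (j' : ℕ) < (k : ℕ) ∧
    f j' < f k ∧ f k < f i ∧ f i < f j

/-- A twisted Baxter permutation avoids both 2-41-3 and 3-41-2. -/
def IsTwistedBaxter {n : ℕ} (π : Equiv.Perm (Fin n)) : Prop :=
  ¬ Contains2413 ⇑π ∧ ¬ Contains3412 ⇑π

/-- Number of twisted Baxter permutations of size `n` with label `(h, k)`: `h`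
(resp. `k`) is the number of active sites weakly below (resp. strictly above)
the last entry. -/
noncomputable def twistedBaxterLabelCount (n h k : ℕ) : ℕ :=
  Nat.card {π : Equiv.Perm (Fin n) // IsTwistedBaxter π ∧
    ∃ hn : 0 < n,
      h = Nat.card {a : Fin (n + 1) //
            (¬ Contains2413 (insertFun π a) ∧ ¬ Contains3412 (insertFun π a)) ∧
            (a : ℕ) ≤ ((π ⟨n - 1, Nat.sub_lt hn Nat.one_pos⟩ : Fin n) : ℕ)} ∧
      k = Nat.card {a : Fin (n + 1) //
            (¬ Contains2413 (insertFun π a) ∧ ¬ Contains3412 (insertFun π a)) ∧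
            ((π ⟨n - 1, Nat.sub_lt hn Nat.one_pos⟩ : Fin n) : ℕ) < (a : ℕ)}}

namespace TwistedBaxter

open Finset

/-- The site `c` lies inside a descent `π_j π_{j+1}` whose interval also contains an entry to the
left of `π_j`. -/
def Blocked {n : ℕ} (π : Equiv.Perm (Fin n)) (c : ℕ) : Prop :=
  ∃ i j j' : Fin n, (i : ℕ) < j ∧ (j' : ℕ) = j + 1 ∧ π j' < π i ∧ π i < π j ∧
    (π j' : ℕ) < c ∧ c ≤ (π j : ℕ)

instance {n : ℕ} (π : Equiv.Perm (Fin n)) : DecidablePred (Blocked π) := fun c => by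
  unfold Blocked; infer_instance

instance {n : ℕ} : DecidablePred (IsTwistedBaxter (n := n)) := fun π => by
  unfold IsTwistedBaxter Contains2413 Contains3412; infer_instance

lemma isTwistedBaxter_iff {n : ℕ} (π : Equiv.Perm (Fin n)) :
    IsTwistedBaxter π ↔ ∀ i j j' k : Fin n, (i : ℕ) < j → (j' : ℕ) = j + 1 → (j' : ℕ) < k →
      π j' < π i → π i < π j → π j' < π k → ¬ π k < π j := by
  constructor
  · rintro ⟨h₁, h₂⟩ i j j' k hij hj hk h1 h2 h3 h4
    rcases lt_trichotomy (π i) (π k) with h | h | h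
    · exact h₁ ⟨i, j, j', k, hij, hj, hk, h1, h, h4⟩
    · have := π.injective h
      subst this
      omega
    · exact h₂ ⟨i, j, j', k, hij, hj, hk, h3, h, h2⟩
  · intro h
    constructor
    · rintro ⟨i, j, j', k, hij, hj, hk, h1, h2, h3⟩
      exact h i j j' k hij hj hk h1 (h2.trans h3) (h1.trans h2) h3
    · rintro ⟨i, j, j', k, hij, hj, hk, h1, h2, h3⟩
      exact h i j j' k hij hj hk (h1.trans h2) h3 h1 (h2.trans h3)

lemma insertFun_castSucc {n : ℕ} (π : Equiv.Perm (Fin n)) (a : Fin (n + 1)) (i : Fin n) :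
    insertFun π a i.castSucc = a.succAbove (π i) := by
  simp only [insertFun, Fin.succAbove, Fin.val_castSucc, i.isLt, dite_true, Fin.lt_def]
  rfl

lemma insertFun_last {n : ℕ} (π : Equiv.Perm (Fin n)) (a : Fin (n + 1)) :
    insertFun π a (Fin.last n) = a := by
  simp [insertFun]

lemma insertFun_injective {n : ℕ} (π : Equiv.Perm (Fin n)) (a : Fin (n + 1)) :
    Function.Injective (insertFun π a) := by
  intro i j
  induction i using Fin.lastCases <;> induction j using Fin.lastCases <;>
    simp [insertFun_castSucc, insertFun_last, Fin.succAbove_ne, Fin.ne_succAbove]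

/-- The permutation `π · a`. -/
noncomputable def insertPerm {n : ℕ} (π : Equiv.Perm (Fin n)) (a : Fin (n + 1)) :
    Equiv.Perm (Fin (n + 1)) :=
  Equiv.ofBijective (insertFun π a) (Finite.injective_iff_bijective.mp (insertFun_injective π a))

@[simp]
lemma coe_insertPerm {n : ℕ} (π : Equiv.Perm (Fin n)) (a : Fin (n + 1)) :
    ⇑(insertPerm π a) = insertFun π a := rfl

lemma insertPerm_bijective (n : ℕ) :
    Function.Bijective fun x : Equiv.Perm (Fin n) × Fin (n + 1) => insertPerm x.1 x.2 := by
  rw [Fintype.bijective_iff_injective_and_card]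
  constructor
  · rintro ⟨π, a⟩ ⟨σ, b⟩ h
    have h' : insertFun π a = insertFun σ b := congrArg (fun τ : Equiv.Perm _ => ⇑τ) h
    have hab : a = b := by simpa [insertFun_last] using congrFun h' (Fin.last n)
    subst hab
    congr 1
    ext i
    have := congrFun h' i.castSucc
    rw [insertFun_castSucc, insertFun_castSucc] at this
    rw [Fin.succAbove_right_injective this]
  · simp [Fintype.card_perm, Nat.factorial_succ, mul_comm]

lemma val_succAbove {n : ℕ} (a : Fin (n + 1)) (x : Fin n) :
    (a.succAbove x : ℕ) = if (x : ℕ) < a then (x : ℕ) else x + 1 := by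
  simp only [Fin.succAbove, Fin.lt_def, Fin.val_castSucc]
  split_ifs <;> rfl

lemma isTwistedBaxter_insertPerm {n : ℕ} (π : Equiv.Perm (Fin n)) (a : Fin (n + 1)) :
    IsTwistedBaxter (insertPerm π a) ↔ IsTwistedBaxter π ∧ ¬ Blocked π a := by
  simp only [isTwistedBaxter_iff, coe_insertPerm, Blocked]
  constructor
  · intro h
    refine ⟨fun i j j' k hij hj hk => ?_, ?_⟩
    · simpa [insertFun_castSucc] using
        h i.castSucc j.castSucc j'.castSucc k.castSucc (by simpa) (by simpa) (by simpa)
    · rintro ⟨i, j, j', hij, hj, h1, h2, h3, h4⟩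
      refine h i.castSucc j.castSucc j'.castSucc (Fin.last n) (by simpa) (by simpa) (by simp)
        ?_ ?_ ?_ ?_
      · simpa [insertFun_castSucc]
      · simpa [insertFun_castSucc]
      · rw [insertFun_castSucc, insertFun_last, Fin.lt_def, val_succAbove]
        split_ifs; omega
      · rw [insertFun_castSucc, insertFun_last, Fin.lt_def, val_succAbove]
        split_ifs <;> omega
  · rintro ⟨h, hb⟩ i j j' k hij hj hk
    induction j' using Fin.lastCases with
    | last => have := k.isLt; simp at hk; omega
    | cast j' =>
    have := j'.isLt
    rw [Fin.val_castSucc] at hj hk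
    induction i using Fin.lastCases with
    | last => simp at hij; omega
    | cast i =>
    induction j using Fin.lastCases with
    | last => simp at hj; omega
    | cast j =>
    rw [Fin.val_castSucc] at hij hj
    rw [Fin.val_castSucc] at hij
    induction k using Fin.lastCases with
    | last =>
      simp only [insertFun_castSucc, insertFun_last, Fin.succAbove_lt_succAbove_iff]
      intro h1 h2 h3 h4
      rw [Fin.lt_def, val_succAbove] at h3 h4
      refine hb ⟨i, j, j', hij, hj, h1, h2, ?_, ?_⟩
      · split_ifs at h3 <;> omega
      · split_ifs at h4 <;> omega
    | cast k =>
      simpa [insertFun_castSucc] using h i j j' k hij hj hk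

lemma avoids_insertFun_iff {n : ℕ} {π : Equiv.Perm (Fin n)} (hπ : IsTwistedBaxter π)
    (a : Fin (n + 1)) :
    (¬ Contains2413 (insertFun π a) ∧ ¬ Contains3412 (insertFun π a)) ↔ ¬ Blocked π a := by
  have := isTwistedBaxter_insertPerm π a
  rw [and_iff_right hπ] at this
  exact this

lemma not_blocked_last {n : ℕ} {π : Equiv.Perm (Fin (n + 1))} (hπ : IsTwistedBaxter π) :
    ¬ Blocked π (π (Fin.last n)) := by
  rintro ⟨i, j, j', hij, hj, h1, h2, h3, h4⟩
  have hlt := j'.isLt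
  by_cases hl : (j' : ℕ) = n
  · rw [show j' = Fin.last n from Fin.ext hl] at h3
    omega
  · refine (isTwistedBaxter_iff π).mp hπ i j j' (Fin.last n) hij hj (by simp; omega) h1 h2 h3
      (lt_of_le_of_ne h4 fun h => ?_)
    have := congrArg Fin.val (π.injective h)
    simp at this
    omega

lemma blocked_insertPerm_of_le {n : ℕ} (π : Equiv.Perm (Fin (n + 1))) (a : Fin (n + 2)) {c : ℕ}
    (hc : c ≤ a) : Blocked (insertPerm π a) c ↔ Blocked π c := by
  constructor
  · rintro ⟨i, j, j', hij, hj, h1, h2, h3, h4⟩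
    rw [coe_insertPerm] at *
    induction j' using Fin.lastCases with
    | last => rw [insertFun_last] at h3; omega
    | cast j' =>
    have := j'.isLt
    rw [Fin.val_castSucc] at hj
    induction i using Fin.lastCases with
    | last => simp at hij; omega
    | cast i =>
    induction j using Fin.lastCases with
    | last => simp at hj; omega
    | cast j =>
    simp only [insertFun_castSucc, Fin.succAbove_lt_succAbove_iff, val_succAbove,
      Fin.val_castSucc] at *
    refine ⟨i, j, j', hij, hj, h1, h2, ?_, ?_⟩
    · split_ifs at h3 <;> omega
    · split_ifs at h4 <;> omega
  · rintro ⟨i, j, j', hij, hj, h1, h2, h3, h4⟩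
    refine ⟨i.castSucc, j.castSucc, j'.castSucc, by simpa, by simpa, ?_⟩
    simp only [coe_insertPerm, insertFun_castSucc, Fin.succAbove_lt_succAbove_iff, val_succAbove]
    refine ⟨h1, h2, ?_, ?_⟩ <;> split_ifs <;> omega

lemma blocked_insertPerm_succ {n : ℕ} (π : Equiv.Perm (Fin (n + 1))) (a : Fin (n + 2)) {c : ℕ}
    (hc : a ≤ c) : Blocked (insertPerm π a) (c + 1) ↔
      Blocked π c ∨ ((a : ℕ) < π (Fin.last n) ∧ c ≤ π (Fin.last n)) := by
  constructor
  · rintro ⟨i, j, j', hij, hj, h1, h2, h3, h4⟩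
    rw [coe_insertPerm] at *
    have := j'.isLt
    induction i using Fin.lastCases with
    | last => simp at hij; omega
    | cast i =>
    induction j using Fin.lastCases with
    | last => simp at hj; omega
    | cast j =>
    induction j' using Fin.lastCases with
    | last =>
      have hjn : j = Fin.last n := by ext; simp at hj ⊢; omega
      subst hjn
      right
      simp only [insertFun_castSucc, insertFun_last, Fin.lt_def, val_succAbove] at *
      split_ifs at h1 h2 h4 <;> omega
    | cast j' =>
      left
      simp only [insertFun_castSucc, Fin.succAbove_lt_succAbove_iff, val_succAbove,
        Fin.val_castSucc] at *
      refine ⟨i, j, j', hij, hj, h1, h2, ?_, ?_⟩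
      · split_ifs at h3 <;> omega
      · split_ifs at h4 <;> omega
  · rintro (⟨i, j, j', hij, hj, h1, h2, h3, h4⟩ | ⟨h1, h2⟩)
    · refine ⟨i.castSucc, j.castSucc, j'.castSucc, by simpa, by simpa, ?_⟩
      simp only [coe_insertPerm, insertFun_castSucc, Fin.succAbove_lt_succAbove_iff,
        val_succAbove]
      refine ⟨h1, h2, ?_, ?_⟩ <;> split_ifs <;> omega
    · have hlt := (π (Fin.last n)).isLt
      set i := π.symm ⟨a, by omega⟩ with hi
      have hπi : (π i : ℕ) = a := by simp [hi]
      have hne : (i : ℕ) ≠ n := fun h => by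
        rw [show i = Fin.last n from Fin.ext h] at hπi
        omega
      refine ⟨i.castSucc, (Fin.last n).castSucc, Fin.last (n + 1), ?_, by simp, ?_⟩
      · have := i.isLt
        simp; omega
      · simp only [coe_insertPerm, insertFun_castSucc, insertFun_last, Fin.lt_def, val_succAbove,
          hπi]
        refine ⟨?_, ?_, by omega, ?_⟩ <;> split_ifs <;> omega

/-- The number of active sites weakly below `c`. -/
def rank {n : ℕ} (π : Equiv.Perm (Fin n)) (c : ℕ) : ℕ :=
  #{d ∈ range (n + 1) | ¬ Blocked π d ∧ d ≤ c}

/-- The number of active sites strictly above `c`. -/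
def corank {n : ℕ} (π : Equiv.Perm (Fin n)) (c : ℕ) : ℕ :=
  #{d ∈ range (n + 1) | ¬ Blocked π d ∧ c < d}

lemma card_fin_subtype (n : ℕ) (p : ℕ → Prop) [DecidablePred p] :
    Nat.card {a : Fin n // p a} = #{d ∈ range n | p d} := by
  rw [Nat.card_eq_fintype_card, Fintype.card_subtype, card_filter, card_filter,
    Fin.sum_univ_eq_sum_range (fun c => if p c then 1 else 0)]

lemma twistedBaxterLabelCount_succ (n h k : ℕ) :
    twistedBaxterLabelCount (n + 1) h k =
      ∑ π : Equiv.Perm (Fin (n + 1)) with IsTwistedBaxter π,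
        if rank π (π (Fin.last n)) = h ∧ corank π (π (Fin.last n)) = k then 1 else 0 := by
  rw [← card_filter, filter_filter, ← Fintype.card_subtype, ← Nat.card_eq_fintype_card,
    twistedBaxterLabelCount]
  refine Nat.card_congr (Equiv.subtypeEquivRight fun π => and_congr_right fun hπ => ?_)
  simp only [avoids_insertFun_iff hπ, Nat.zero_lt_succ, exists_true_left]
  rw [card_fin_subtype (n + 2) fun a => ¬ Blocked π a ∧ a ≤ _,
    card_fin_subtype (n + 2) fun a => ¬ Blocked π a ∧ _ < a]
  exact and_congr eq_comm eq_comm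

lemma rank_add_corank {n : ℕ} (π : Equiv.Perm (Fin n)) (c : ℕ) :
    rank π c + corank π c = #{d ∈ range (n + 1) | ¬ Blocked π d} := by
  rw [← card_filter_add_card_filter_not (s := {d ∈ range (n + 1) | ¬ Blocked π d}) (· ≤ c)]
  simp [rank, corank, filter_filter]

lemma rank_mono {n : ℕ} (π : Equiv.Perm (Fin n)) : Monotone (rank π) := fun a b hab =>
  card_le_card fun d => by
    simp only [mem_filter]
    exact fun h => ⟨h.1, h.2.1, h.2.2.trans hab⟩

lemma rank_lt_rank {n : ℕ} (π : Equiv.Perm (Fin n)) {a b : ℕ} (hab : a < b) (hb : b ≤ n)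
    (hb' : ¬ Blocked π b) : rank π a < rank π b := by
  refine card_lt_card ⟨fun d => ?_, fun h => ?_⟩
  · simp only [mem_filter]
    exact fun h => ⟨h.1, h.2.1, h.2.2.trans hab.le⟩
  · have : b ∈ ({d ∈ range (n + 1) | ¬ Blocked π d ∧ d ≤ b} : Finset ℕ) := by
      simp [hb']; omega
    have := h this
    simp at this
    omega

lemma rank_pos {n : ℕ} (π : Equiv.Perm (Fin n)) (c : ℕ) : 0 < rank π c :=
  card_pos.mpr ⟨0, by rw [mem_filter]; simp [Blocked]⟩

lemma rank_le {n : ℕ} (π : Equiv.Perm (Fin n)) (c : ℕ) : rank π c ≤ n + 1 :=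
  (card_filter_le _ _).trans (card_range _).le

lemma image_rank {n : ℕ} (π : Equiv.Perm (Fin n)) :
    ({d ∈ range (n + 1) | ¬ Blocked π d} : Finset ℕ).image (rank π) =
      Icc 1 #{d ∈ range (n + 1) | ¬ Blocked π d} := by
  refine eq_of_subset_of_card_le (fun m hm => ?_) ?_
  · obtain ⟨c, -, rfl⟩ := mem_image.mp hm
    rw [mem_Icc]
    exact ⟨rank_pos π c, (rank_add_corank π c).le.trans' (Nat.le_add_right _ _)⟩
  · rw [card_image_of_injOn]
    · simp
    · intro a ha b hb hab
      simp only [coe_filter, mem_range, Set.mem_ofPred_eq] at ha hb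
      rcases lt_trichotomy a b with h | h | h
      · exact absurd hab (rank_lt_rank π h (by omega) hb.2).ne
      · exact h
      · exact absurd hab (rank_lt_rank π h (by omega) ha.2).ne'

lemma rank_insertPerm {n : ℕ} (π : Equiv.Perm (Fin (n + 1))) (a : Fin (n + 2)) :
    rank (insertPerm π a) a = rank π a := by
  unfold rank
  congr 1
  ext d
  have := a.isLt
  simp only [mem_filter, mem_range]
  constructor
  · rintro ⟨h1, h2, h3⟩
    exact ⟨by omega, by rwa [blocked_insertPerm_of_le π a h3] at h2, h3⟩
  · rintro ⟨h1, h2, h3⟩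
    exact ⟨by omega, by rwa [blocked_insertPerm_of_le π a h3], h3⟩

lemma corank_insertPerm {n : ℕ} (π : Equiv.Perm (Fin (n + 1))) (a : Fin (n + 2)) :
    corank (insertPerm π a) a = #{d ∈ range (n + 2) | ¬ Blocked π d ∧ (a : ℕ) ≤ d ∧
      ¬ ((a : ℕ) < π (Fin.last n) ∧ d ≤ π (Fin.last n))} := by
  unfold corank
  symm
  refine card_bij (fun d _ => d + 1) ?_ (fun _ _ _ _ h => by simpa using h) ?_
  · intro d hd
    simp only [mem_filter, mem_range] at hd ⊢
    rw [blocked_insertPerm_succ π a hd.2.2.1]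
    grind
  · intro d hd
    simp only [mem_filter, mem_range] at hd
    obtain ⟨c, rfl⟩ := Nat.exists_eq_add_one_of_ne_zero (show d ≠ 0 by omega)
    rw [blocked_insertPerm_succ π a (by omega)] at hd
    refine ⟨c, ?_, rfl⟩
    simp only [mem_filter, mem_range]
    grind

lemma corank_insertPerm_of_lt {n : ℕ} (π : Equiv.Perm (Fin (n + 1))) (a : Fin (n + 2))
    (ha : (a : ℕ) < π (Fin.last n)) :
    corank (insertPerm π a) a = corank π (π (Fin.last n)) := by
  rw [corank_insertPerm, corank]
  congr 1
  ext d
  simp only [mem_filter]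
  refine and_congr_right fun _ => and_congr_right fun _ => ?_
  omega

lemma corank_insertPerm_of_le {n : ℕ} (π : Equiv.Perm (Fin (n + 1))) (a : Fin (n + 2))
    (ha : (π (Fin.last n) : ℕ) ≤ a) (hb : ¬ Blocked π a) :
    corank (insertPerm π a) a = corank π a + 1 := by
  rw [corank_insertPerm, corank, ← card_insert_of_notMem (a := (a : ℕ)) (by simp)]
  congr 1
  ext d
  have := a.isLt
  simp only [mem_filter, mem_insert, mem_range]
  constructor
  · rintro ⟨h1, h2, h3, -⟩
    rcases h3.eq_or_lt with h | h
    · exact Or.inl h.symm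
    · exact Or.inr ⟨h1, h2, h⟩
  · rintro (rfl | ⟨h1, h2, h3⟩)
    · exact ⟨this, hb, le_rfl, by omega⟩
    · exact ⟨h1, h2, h3.le, by omega⟩

/-- The succession rule: how often a child of `π` has label `(h, k)`. -/
lemma sum_label_insertPerm {n : ℕ} {π : Equiv.Perm (Fin (n + 1))} (hπ : IsTwistedBaxter π)
    {h k : ℕ} (hh : 1 ≤ h) (hk : 1 ≤ k) :
    (∑ a : Fin (n + 2), if ¬ Blocked π a ∧ rank (insertPerm π a) a = h ∧
        corank (insertPerm π a) a = k then 1 else 0) =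
      if (h < rank π (π (Fin.last n)) ∧ corank π (π (Fin.last n)) = k) ∨
        (rank π (π (Fin.last n)) ≤ h ∧
          h + k = rank π (π (Fin.last n)) + corank π (π (Fin.last n)) + 1) then 1 else 0 := by
  set p : ℕ := (π (Fin.last n)).val with hp
  have hpb : ¬ Blocked π p := not_blocked_last hπ
  have hpn : p < n + 1 := (π (Fin.last n)).isLt
  have key (a : Fin (n + 2)) : (¬ Blocked π a ∧ rank (insertPerm π a) a = h ∧
        corank (insertPerm π a) a = k) ↔ (¬ Blocked π a ∧ rank π a = h) ∧
        ((h < rank π p ∧ corank π p = k) ∨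
          (rank π p ≤ h ∧ h + k = rank π p + corank π p + 1)) := by
    rw [rank_insertPerm, and_assoc]
    refine and_congr_right fun hb => and_congr_right fun hr => ?_
    rcases lt_or_ge (a : ℕ) p with hap | hap
    · have := rank_lt_rank π hap hpn.le hpb
      rw [corank_insertPerm_of_lt π a hap, ← hp]
      omega
    · have := rank_mono π hap
      rw [corank_insertPerm_of_le π a hap hb]
      have := rank_add_corank π a
      have := rank_add_corank π p
      omega
  simp only [key]
  split_ifs with hc
  · simp only [hc, and_true]
    have hmem : h ∈ Icc 1 #{d ∈ range (n + 2) | ¬ Blocked π d} := by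
      rw [mem_Icc, ← rank_add_corank π p]
      omega
    rw [← image_rank, mem_image] at hmem
    obtain ⟨c, hc1, hc2⟩ := hmem
    simp only [mem_filter, mem_range] at hc1
    rw [sum_eq_single_of_mem ⟨c, hc1.1⟩ (mem_univ _), if_pos ⟨hc1.2, hc2⟩]
    intro b _ hbc
    rw [if_neg]
    rintro ⟨hb1, hb2⟩
    rcases lt_trichotomy (b : ℕ) c with hl | hl | hl
    · have := rank_lt_rank π hl (by omega) hc1.2
      omega
    · exact hbc (Fin.ext hl)
    · have := rank_lt_rank π hl (by omega) hb1
      omega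
  · simp [hc]

lemma twistedBaxterLabelCount_succ_succ (n : ℕ) {h k : ℕ} (hh : 1 ≤ h) (hk : 1 ≤ k) :
    twistedBaxterLabelCount (n + 2) h k =
      ∑ π : Equiv.Perm (Fin (n + 1)) with IsTwistedBaxter π,
        if (h < rank π (π (Fin.last n)) ∧ corank π (π (Fin.last n)) = k) ∨
          (rank π (π (Fin.last n)) ≤ h ∧
            h + k = rank π (π (Fin.last n)) + corank π (π (Fin.last n)) + 1) then 1 else 0 := by
  rw [twistedBaxterLabelCount_succ, sum_filter,
    ← (insertPerm_bijective (n + 1)).sum_comp, Fintype.sum_prod_type, sum_filter]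
  refine sum_congr rfl fun π _ => ?_
  simp only [isTwistedBaxter_insertPerm, coe_insertPerm, insertFun_last]
  by_cases hπ : IsTwistedBaxter π
  · simpa only [hπ, true_and, if_true, ← ite_and] using sum_label_insertPerm hπ hh hk
  · simp only [hπ, false_and, if_false, sum_const_zero]

lemma tsum_twistedBaxterLabelCount (n h k : ℕ) :
    (∑' h' : ℕ, if h < h' then twistedBaxterLabelCount (n + 1) h' k else 0) =
      ∑ π : Equiv.Perm (Fin (n + 1)) with IsTwistedBaxter π,
        if h < rank π (π (Fin.last n)) ∧ corank π (π (Fin.last n)) = k then 1 else 0 := by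
  simp only [twistedBaxterLabelCount_succ]
  rw [tsum_eq_sum (s := range (n + 3))]
  · rw [← sum_filter, sum_comm]
    refine sum_congr rfl fun π _ => ?_
    have := rank_le π (π (Fin.last n))
    simp only [ite_and, sum_ite_eq, mem_filter, mem_range]
    split_ifs <;> omega
  · intro h' hh'
    split_ifs
    · refine sum_eq_zero fun π _ => if_neg ?_
      have := rank_le π (π (Fin.last n))
      simp only [mem_range] at hh'
      omega
    · rfl

lemma sum_Ico_twistedBaxterLabelCount (n h : ℕ) {k : ℕ} (hk : 1 ≤ k) :
    ∑ m ∈ Ico 1 h, twistedBaxterLabelCount (n + 1) m (h + k - 1 - m) =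
      ∑ π : Equiv.Perm (Fin (n + 1)) with IsTwistedBaxter π,
        if rank π (π (Fin.last n)) < h ∧
          h + k = rank π (π (Fin.last n)) + corank π (π (Fin.last n)) + 1 then 1 else 0 := by
  simp only [twistedBaxterLabelCount_succ]
  rw [sum_comm]
  refine sum_congr rfl fun π _ => ?_
  have := rank_pos π (π (Fin.last n))
  simp only [ite_and, sum_ite_eq, mem_Ico]
  split_ifs <;> omega

lemma twistedBaxterLabelCount_one (h k : ℕ) :
    twistedBaxterLabelCount 1 h k = if 1 = h ∧ 1 = k then 1 else 0 := by
  have hb (π : Equiv.Perm (Fin 1)) (c : ℕ) : ¬ Blocked π c := by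
    rintro ⟨i, j, -, hij, -⟩
    omega
  have ht (π : Equiv.Perm (Fin 1)) : IsTwistedBaxter π := by
    rw [isTwistedBaxter_iff]
    intro i j
    omega
  have hr (π : Equiv.Perm (Fin 1)) : rank π 0 = 1 := by simp [rank, hb]
  have hc (π : Equiv.Perm (Fin 1)) : corank π 0 = 1 := by simp [corank, hb]; rfl
  rw [twistedBaxterLabelCount_succ]
  simp [ht, hr, hc]

end TwistedBaxter

/-- The recurrence on label counts encoded by the succession rule `Ω_TBax`
(Proposition 4.2): the label `(h,k)` produces `(1,k),…,(h−1,k),(h,k+1)` and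
`(h+k,1),…,(h+1,k)`. -/
theorem twistedBaxter_omega_TBax :
    twistedBaxterLabelCount 1 1 1 = 1 ∧
    (∀ h k : ℕ, 1 ≤ h → 1 ≤ k → (h, k) ≠ (1, 1) → twistedBaxterLabelCount 1 h k = 0) ∧
    (∀ n h k : ℕ, 1 ≤ n → 1 ≤ h → 1 ≤ k →
      twistedBaxterLabelCount (n + 1) h k =
        (∑' h' : ℕ, if h < h' then twistedBaxterLabelCount n h' k else 0) +
          twistedBaxterLabelCount n h (k - 1) +
          ∑ m ∈ Finset.Ico 1 h, twistedBaxterLabelCount n m (h + k - 1 - m)) := by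
  refine ⟨by simp [TwistedBaxter.twistedBaxterLabelCount_one], ?_, ?_⟩
  · intro h k _ _ hne
    rw [TwistedBaxter.twistedBaxterLabelCount_one, if_neg]
    rintro ⟨rfl, rfl⟩
    exact hne rfl
  · intro n h k hn hh hk
    obtain ⟨n, rfl⟩ := Nat.exists_eq_add_of_le' hn
    rw [TwistedBaxter.twistedBaxterLabelCount_succ_succ n hh hk,
      TwistedBaxter.tsum_twistedBaxterLabelCount,
      TwistedBaxter.sum_Ico_twistedBaxterLabelCount n h hk,
      TwistedBaxter.twistedBaxterLabelCount_succ, ← Finset.sum_add_distrib,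
      ← Finset.sum_add_distrib]
    refine Finset.sum_congr rfl fun π _ => ?_
    split_ifs <;> omega
end

section
/- Let S₂ be the step multiset {(−1,0), (0,−1), (1,−1), (1,0), (0,1)} together with two distinguished copies of the trivial step (0,0). For every n ≥ 0, the number of strong-Baxter permutations of size n+1 equals the number of walks of length n starting and ending at (0,0), using steps from S₂, all of whose partial sums have both coordinates nonnegative (walks differing only in which of the two copies of (0,0) is used are counted as distinct). (Consequence of eq. (JW2) of Lemma 5.6, specialized at a = b = 0: I(x;1,1) = x·W₂(x;0,0).) -/
/-- `f` contains the vincular pattern 3-14-2. -/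
def Contains3142 {m : ℕ} (f : Fin m → Fin m) : Prop :=
  ∃ i j j' k : Fin m, (i : ℕ) < (j : ℕ) ∧ (j' : ℕ) = (j : ℕ) + 1 ∧ (j' : ℕ) < (k : ℕ) ∧
    f j < f k ∧ f k < f i ∧ f i < f j'

/-- A strong-Baxter permutation avoids 2-41-3, 3-14-2 and 3-41-2. -/
def IsStrongBaxter {n : ℕ} (π : Equiv.Perm (Fin n)) : Prop :=
  ¬ Contains2413 ⇑π ∧ ¬ Contains3142 ⇑π ∧ ¬ Contains3412 ⇑π

/-- The number of strong-Baxter permutations of size `n`. -/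
noncomputable def strongBaxterCount (n : ℕ) : ℕ :=
  Nat.card {π : Equiv.Perm (Fin n) // IsStrongBaxter π}

/-- The number of walks of length `n` in the quarter plane starting at the
origin, with steps indexed by `σ` via `step` (indices give multiplicity: walks
using different indices with the same step vector are distinct), all of whose
partial sums have nonnegative coordinates, and ending at `p`. -/
noncomputable def walkCount {σ : Type} (step : σ → ℤ × ℤ) (n : ℕ) (p : ℤ × ℤ) : ℕ :=
  Nat.card {w : Fin n → σ //
    (∀ r : ℕ, r ≤ n →
      0 ≤ (∑ t : Fin n, if (t : ℕ) < r then step (w t) else 0).1 ∧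
      0 ≤ (∑ t : Fin n, if (t : ℕ) < r then step (w t) else 0).2) ∧
    (∑ t : Fin n, step (w t)) = p}

/-- The step multiset `S₂ = {(−1,0),(0,−1),(1,−1),(1,0),(0,1)} ∪ {(0,0),(0,0)}`,
with two distinguished copies of the trivial step `(0,0)`. -/
def stepS2 : Fin 7 → ℤ × ℤ := ![(-1, 0), (0, -1), (1, -1), (1, 0), (0, 1), (0, 0), (0, 0)]

open Finset

/-! ### Appending a last entry to a permutation -/

/-- The permutation obtained from `σ` by appending the value `a` and shifting up the values
that are at least `a`. -/
def insertLast {m : ℕ} (a : Fin (m + 1)) (σ : Equiv.Perm (Fin m)) : Equiv.Perm (Fin (m + 1)) :=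
  (finSuccEquiv' (Fin.last m)).trans ((Equiv.optionCongr σ).trans (finSuccEquiv' a).symm)

@[simp] lemma insertLast_last {m : ℕ} (a : Fin (m + 1)) (σ : Equiv.Perm (Fin m)) :
    insertLast a σ (Fin.last m) = a := by
  simp [insertLast]

@[simp] lemma insertLast_castSucc {m : ℕ} (a : Fin (m + 1)) (σ : Equiv.Perm (Fin m))
    (i : Fin m) : insertLast a σ i.castSucc = a.succAbove (σ i) := by
  simp [insertLast, finSuccEquiv'_last_apply_castSucc]

lemma insertLast_bijective (m : ℕ) :
    Function.Bijective fun x : Fin (m + 1) × Equiv.Perm (Fin m) ↦ insertLast x.1 x.2 := by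
  rw [Fintype.bijective_iff_injective_and_card]
  refine ⟨?_, ?_⟩
  · rintro ⟨a, σ⟩ ⟨b, τ⟩ h
    have hab : a = b := by simpa using congrArg (fun f ↦ f (Fin.last m)) h
    subst hab
    refine Prod.ext rfl (Equiv.ext fun i ↦ ?_)
    simpa using congrArg (fun f ↦ f i.castSucc) h
  · simp [Fintype.card_perm, Nat.factorial_succ]

lemma val_succAbove {m : ℕ} (a : Fin (m + 1)) (x : Fin m) :
    ((a.succAbove x : Fin (m + 1)) : ℕ) = if (x : ℕ) < a then (x : ℕ) else x + 1 := by
  simp only [Fin.succAbove, Fin.lt_def, Fin.val_castSucc]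
  split_ifs <;> simp

/-- Appending a new last value at height `b` to `f` creates one of the three patterns. -/
def BadSite {m : ℕ} (f : Fin m → Fin m) (b : ℕ) : Prop :=
  ∃ i j j' : Fin m, (i : ℕ) < j ∧ (j' : ℕ) = j + 1 ∧
    (((f j' : ℕ) < f i ∧ (f i : ℕ) < b ∧ b ≤ f j) ∨
      ((f j : ℕ) < b ∧ b ≤ f i ∧ (f i : ℕ) < f j') ∨
      ((f j' : ℕ) < b ∧ b ≤ f i ∧ (f i : ℕ) < f j))

/-- `f` contains one of the three patterns. -/
def ContainsPattern {m : ℕ} (f : Fin m → Fin m) : Prop :=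
  ∃ i j j' k : Fin m, (i : ℕ) < j ∧ (j' : ℕ) = j + 1 ∧ (j' : ℕ) < k ∧
    (((f j' : ℕ) < f i ∧ (f i : ℕ) < f k ∧ (f k : ℕ) < f j) ∨
      ((f j : ℕ) < f k ∧ (f k : ℕ) < f i ∧ (f i : ℕ) < f j') ∨
      ((f j' : ℕ) < f k ∧ (f k : ℕ) < f i ∧ (f i : ℕ) < f j))

lemma isStrongBaxter_iff {m : ℕ} (σ : Equiv.Perm (Fin m)) :
    IsStrongBaxter σ ↔ ¬ ContainsPattern σ := by
  rw [IsStrongBaxter, ← not_or, ← not_or, not_iff_not]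
  constructor
  · rintro (⟨i, j, j', k, h1, h2, h3, h⟩ | ⟨i, j, j', k, h1, h2, h3, h⟩ |
      ⟨i, j, j', k, h1, h2, h3, h⟩)
    exacts [⟨i, j, j', k, h1, h2, h3, Or.inl h⟩, ⟨i, j, j', k, h1, h2, h3, Or.inr (Or.inl h)⟩,
      ⟨i, j, j', k, h1, h2, h3, Or.inr (Or.inr h)⟩]
  · rintro ⟨i, j, j', k, h1, h2, h3, h | h | h⟩
    exacts [Or.inl ⟨i, j, j', k, h1, h2, h3, h⟩, Or.inr (Or.inl ⟨i, j, j', k, h1, h2, h3, h⟩),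
      Or.inr (Or.inr ⟨i, j, j', k, h1, h2, h3, h⟩)]

lemma isStrongBaxter_insertLast {m : ℕ} (a : Fin (m + 1)) (σ : Equiv.Perm (Fin m)) :
    IsStrongBaxter (insertLast a σ) ↔ IsStrongBaxter σ ∧ ¬ BadSite σ a := by
  rw [isStrongBaxter_iff, isStrongBaxter_iff, ← not_or, not_iff_not]
  constructor
  · rintro ⟨i, j, j', k, h1, h2, h3, h⟩
    have hk := k.isLt
    obtain ⟨i, rfl⟩ : ∃ t : Fin m, t.castSucc = i := ⟨⟨i, by omega⟩, rfl⟩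
    obtain ⟨j, rfl⟩ : ∃ t : Fin m, t.castSucc = j := ⟨⟨j, by omega⟩, rfl⟩
    obtain ⟨j', rfl⟩ : ∃ t : Fin m, t.castSucc = j' := ⟨⟨j', by omega⟩, rfl⟩
    simp only [Fin.val_castSucc] at h1 h2 h3
    induction k using Fin.lastCases with
    | last =>
      refine Or.inr ⟨i, j, j', h1, h2, ?_⟩
      simp only [insertLast_castSucc, insertLast_last, val_succAbove] at h
      split_ifs at h <;> omega
    | cast k =>
      refine Or.inl ⟨i, j, j', k, h1, h2, h3, ?_⟩
      simp only [insertLast_castSucc, val_succAbove] at h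
      split_ifs at h <;> omega
  · rintro (⟨i, j, j', k, h1, h2, h3, h⟩ | ⟨i, j, j', h1, h2, h⟩)
    · refine ⟨i.castSucc, j.castSucc, j'.castSucc, k.castSucc, h1, h2, h3, ?_⟩
      simp only [insertLast_castSucc, val_succAbove]
      split_ifs <;> omega
    · refine ⟨i.castSucc, j.castSucc, j'.castSucc, Fin.last m, h1, h2, j'.isLt, ?_⟩
      simp only [insertLast_castSucc, insertLast_last, val_succAbove]
      split_ifs <;> omega

lemma badSite_insertLast {m : ℕ} (a : Fin (m + 2)) (σ : Equiv.Perm (Fin (m + 1))) (b : ℕ) :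
    BadSite (insertLast a σ) b ↔ BadSite σ (if b ≤ a then b else b - 1) ∨
      ((a : ℕ) < σ (Fin.last m) ∧ (a : ℕ) < b ∧ b ≤ σ (Fin.last m) + 1) ∨
      ((σ (Fin.last m) : ℕ) < b ∧ b < a) := by
  have ha := a.isLt
  have hl := (σ (Fin.last m)).isLt
  constructor
  · rintro ⟨i, j, j', h1, h2, h⟩
    have hj' := j'.isLt
    obtain ⟨i, rfl⟩ : ∃ t : Fin (m + 1), t.castSucc = i := ⟨⟨i, by omega⟩, rfl⟩
    obtain ⟨j, rfl⟩ : ∃ t : Fin (m + 1), t.castSucc = j := ⟨⟨j, by omega⟩, rfl⟩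
    simp only [Fin.val_castSucc] at h1 h2
    induction j' using Fin.lastCases with
    | last =>
      right
      obtain rfl : j = Fin.last m := by
        ext
        simp only [Fin.val_last] at h2 ⊢
        omega
      simp only [insertLast_castSucc, insertLast_last, val_succAbove] at h
      split_ifs at h <;> omega
    | cast j' =>
      refine Or.inl ⟨i, j, j', h1, h2, ?_⟩
      simp only [insertLast_castSucc, val_succAbove] at h
      split_ifs at h ⊢ <;> omega
  · rintro (⟨i, j, j', h1, h2, h⟩ | h)
    · refine ⟨i.castSucc, j.castSucc, j'.castSucc, h1, h2, ?_⟩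
      simp only [insertLast_castSucc, val_succAbove]
      split_ifs at h ⊢ <;> omega
    · have key : ∀ v : ℕ, v < m + 1 → v ≠ σ (Fin.last m) →
          ∃ i : Fin (m + 1), (i : ℕ) < Fin.last m ∧ (σ i : ℕ) = v := by
        intro v hv hne
        refine ⟨σ.symm ⟨v, hv⟩, ?_, by simp⟩
        refine Fin.lt_last_iff_ne_last.2 fun h ↦ hne ?_
        rw [← h]
        simp
      obtain ⟨i, hi, hv⟩ : ∃ i : Fin (m + 1), (i : ℕ) < Fin.last m ∧
          (σ i : ℕ) = if (a : ℕ) < σ (Fin.last m) then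
            (if b = a + 1 then (a : ℕ) else (a : ℕ) + (b - a - 2)) else b := by
        apply key <;> split_ifs <;> omega
      refine ⟨i.castSucc, (Fin.last m).castSucc, Fin.last (m + 1), hi, rfl, ?_⟩
      simp only [insertLast_castSucc, insertLast_last, val_succAbove]
      split_ifs at hv ⊢ <;> omega

lemma not_badSite_last {m : ℕ} (σ : Equiv.Perm (Fin (m + 1))) (hσ : IsStrongBaxter σ) :
    ¬ BadSite σ (σ (Fin.last m)) := by
  rw [isStrongBaxter_iff] at hσ
  rintro ⟨i, j, j', h1, h2, h⟩
  have hj' : j' ≠ Fin.last m := by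
    rintro rfl
    omega
  have hlt : (j' : ℕ) < Fin.last m := Fin.lt_last_iff_ne_last.2 hj'
  have hi : (σ i : ℕ) ≠ σ (Fin.last m) := fun h ↦ by
    have := σ.injective (Fin.ext h)
    subst this
    omega
  have hj : (σ j : ℕ) ≠ σ (Fin.last m) := fun h ↦ by
    have := σ.injective (Fin.ext h)
    subst this
    omega
  exact hσ ⟨i, j, j', Fin.last m, h1, h2, hlt, by omega⟩

lemma not_badSite_top {m : ℕ} (σ : Equiv.Perm (Fin m)) : ¬ BadSite σ m := by
  rintro ⟨i, j, j', h1, h2, h⟩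
  have := (σ i).isLt
  have := (σ j).isLt
  omega

/-! ### The generating tree -/

open Classical in
/-- The active sites strictly below the last value. -/
noncomputable def lowSites {m : ℕ} (σ : Equiv.Perm (Fin (m + 1))) : Finset ℕ :=
  {b ∈ range (σ (Fin.last m)) | ¬ BadSite σ b}

open Classical in
/-- The active sites above the last value. -/
noncomputable def highSites {m : ℕ} (σ : Equiv.Perm (Fin (m + 1))) : Finset ℕ :=
  {b ∈ Ioc (σ (Fin.last m) : ℕ) (m + 1) | ¬ BadSite σ b}

lemma mem_lowSites {m : ℕ} {σ : Equiv.Perm (Fin (m + 1))} {b : ℕ} :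
    b ∈ lowSites σ ↔ b < σ (Fin.last m) ∧ ¬ BadSite σ b := by
  simp [lowSites]

lemma mem_highSites {m : ℕ} {σ : Equiv.Perm (Fin (m + 1))} {b : ℕ} :
    b ∈ highSites σ ↔ ((σ (Fin.last m) : ℕ) < b ∧ b ≤ m + 1) ∧ ¬ BadSite σ b := by
  simp [highSites]

lemma card_highSites_pos {m : ℕ} (σ : Equiv.Perm (Fin (m + 1))) : 0 < #(highSites σ) :=
  card_pos.2 ⟨m + 1, mem_highSites.2
    ⟨⟨(σ (Fin.last m)).isLt, le_rfl⟩, not_badSite_top σ⟩⟩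

lemma card_eq_of_mem_iff_succ {s t : Finset ℕ} (h0 : 0 ∉ s) (h : ∀ b, b + 1 ∈ s ↔ b ∈ t) :
    #s = #t := by
  have : s = t.map (addRightEmbedding 1) := by
    ext b
    cases b with
    | zero => simpa using h0
    | succ b => simp [h]
  rw [this, card_map]

section Children

variable {m : ℕ} (a : Fin (m + 2)) (σ : Equiv.Perm (Fin (m + 1)))

lemma lowSites_insertLast_of_le (h : (a : ℕ) ≤ σ (Fin.last m)) :
    lowSites (insertLast a σ) = {b ∈ lowSites σ | b < (a : ℕ)} := by
  ext b
  rw [mem_filter, mem_lowSites, mem_lowSites, insertLast_last, badSite_insertLast]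
  by_cases hb : b < a
  · rw [if_pos hb.le]
    have : b < σ (Fin.last m) := by omega
    simp only [hb, this, true_and, and_true, not_or]
    exact ⟨fun h ↦ h.1, fun h ↦ ⟨h, by omega, by omega⟩⟩
  · simp [hb]

lemma lowSites_insertLast_of_gt (hσ : IsStrongBaxter σ) (h : (σ (Fin.last m) : ℕ) < a) :
    lowSites (insertLast a σ) = insert (σ (Fin.last m) : ℕ) (lowSites σ) := by
  ext b
  rw [mem_insert, mem_lowSites, mem_lowSites, insertLast_last, badSite_insertLast]
  by_cases hb : b ≤ a
  · rw [if_pos hb]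
    rcases lt_trichotomy b (σ (Fin.last m) : ℕ) with h1 | h1 | h1
    · have h2 : b < a := by omega
      have h3 : ¬ b = σ (Fin.last m) := by omega
      simp only [h1, h2, h3, true_and, not_or, false_or]
      exact ⟨fun h ↦ h.1, fun h ↦ ⟨h, by omega, by omega⟩⟩
    · subst h1
      simp only [h, true_and, true_or, iff_true, not_or]
      exact ⟨not_badSite_last σ hσ, by omega, by omega⟩
    · constructor
      · rintro ⟨h2, h3⟩
        exact absurd (Or.inr (Or.inr ⟨h1, h2⟩)) h3
      · rintro (h2 | h2) <;> omega
  · constructor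
    · rintro ⟨h2, h3⟩
      omega
    · rintro (h2 | h2) <;> omega

lemma card_highSites_insertLast_of_lt (h : (a : ℕ) < σ (Fin.last m)) :
    #(highSites (insertLast a σ)) = #(highSites σ) := by
  refine card_eq_of_mem_iff_succ (by simp [mem_highSites]) fun b ↦ ?_
  rw [mem_highSites, mem_highSites, insertLast_last, badSite_insertLast]
  constructor
  · rintro ⟨h1, h2⟩
    rw [if_neg (by omega), not_or, Nat.add_sub_cancel] at h2
    exact ⟨by omega, h2.1⟩
  · rintro ⟨h1, h2⟩
    rw [if_neg (by omega), not_or, Nat.add_sub_cancel]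
    exact ⟨by omega, h2, by omega⟩

lemma card_highSites_insertLast_of_eq (hσ : IsStrongBaxter σ) (h : (a : ℕ) = σ (Fin.last m)) :
    #(highSites (insertLast a σ)) = #(highSites σ) + 1 := by
  have hn : (σ (Fin.last m) : ℕ) ∉ highSites σ := by simp [mem_highSites]
  rw [← card_insert_of_notMem hn]
  refine card_eq_of_mem_iff_succ (by simp [mem_highSites]) fun b ↦ ?_
  rw [mem_insert, mem_highSites, mem_highSites, insertLast_last, badSite_insertLast]
  constructor
  · rintro ⟨h1, h2⟩
    rw [if_neg (by omega), not_or, Nat.add_sub_cancel] at h2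
    rcases eq_or_ne b (σ (Fin.last m) : ℕ) with h3 | h3
    · exact Or.inl h3
    · exact Or.inr ⟨by omega, h2.1⟩
  · have hl := (σ (Fin.last m)).isLt
    rintro (h1 | ⟨h1, h2⟩)
    · rw [if_neg (by omega), not_or, Nat.add_sub_cancel]
      exact ⟨by omega, h1 ▸ not_badSite_last σ hσ, by omega⟩
    · rw [if_neg (by omega), not_or, Nat.add_sub_cancel]
      exact ⟨by omega, h2, by omega⟩

lemma card_highSites_insertLast_of_gt (h : (σ (Fin.last m) : ℕ) < a) :
    #(highSites (insertLast a σ)) = #{b ∈ highSites σ | (a : ℕ) ≤ b} := by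
  refine card_eq_of_mem_iff_succ (by simp [mem_highSites]) fun b ↦ ?_
  rw [mem_filter, mem_highSites, mem_highSites, insertLast_last, badSite_insertLast]
  constructor
  · rintro ⟨h1, h2⟩
    rw [if_neg (by omega), not_or, Nat.add_sub_cancel] at h2
    exact ⟨⟨by omega, h2.1⟩, by omega⟩
  · rintro ⟨⟨h1, h2⟩, h3⟩
    rw [if_neg (by omega), not_or, Nat.add_sub_cancel]
    exact ⟨by omega, h2, by omega⟩

end Children

lemma sum_card_filter_lt (s : Finset ℕ) (G : ℕ → ℕ) :
    ∑ a ∈ s, G #{b ∈ s | b < a} = ∑ t ∈ range #s, G t := by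
  induction s using Finset.induction_on_max with
  | empty => simp
  | insert x s hx ih =>
    have hxs : x ∉ s := fun h ↦ lt_irrefl _ (hx x h)
    rw [sum_insert hxs, card_insert_of_notMem hxs, sum_range_succ, ← ih, add_comm]
    congr 1
    · refine sum_congr rfl fun a ha ↦ ?_
      rw [filter_insert, if_neg (hx a ha).not_gt]
    · rw [filter_insert, if_neg (lt_irrefl x), filter_true_of_mem hx]

lemma sum_card_filter_ge (s : Finset ℕ) (G : ℕ → ℕ) :
    ∑ a ∈ s, G (#{b ∈ s | a ≤ b} - 1) = ∑ t ∈ range #s, G t := by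
  induction s using Finset.induction_on_min with
  | empty => simp
  | insert x s hx ih =>
    have hxs : x ∉ s := fun h ↦ lt_irrefl _ (hx x h)
    rw [sum_insert hxs, card_insert_of_notMem hxs, sum_range_succ, ← ih, add_comm]
    congr 1
    · refine sum_congr rfl fun a ha ↦ ?_
      rw [filter_insert, if_neg (hx a ha).not_ge]
    · rw [filter_insert, if_pos le_rfl, filter_true_of_mem fun y hy ↦ (hx y hy).le,
        card_insert_of_notMem hxs, Nat.add_sub_cancel]

open Classical in
lemma sum_children {m : ℕ} (σ : Equiv.Perm (Fin (m + 1))) (hσ : IsStrongBaxter σ)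
    (F : ℕ → ℕ → ℕ) :
    (∑ a : Fin (m + 2), if ¬ BadSite σ a then
      F #(lowSites (insertLast a σ)) (#(highSites (insertLast a σ)) - 1) else 0) =
    ∑ t ∈ range #(lowSites σ), F t (#(highSites σ) - 1) + F #(lowSites σ) #(highSites σ) +
      ∑ t ∈ range #(highSites σ), F (#(lowSites σ) + 1) t := by
  set l : ℕ := (σ (Fin.last m) : ℕ) with hl
  have hlt : l < m + 1 := (σ (Fin.last m)).isLt
  let G : ℕ → ℕ := fun a ↦
    if a < l then F #{b ∈ lowSites σ | b < a} (#(highSites σ) - 1)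
    else if a = l then F #(lowSites σ) #(highSites σ)
    else F (#(lowSites σ) + 1) (#{b ∈ highSites σ | a ≤ b} - 1)
  have hG : ∀ a : Fin (m + 2),
      F #(lowSites (insertLast a σ)) (#(highSites (insertLast a σ)) - 1) = G a := by
    intro a
    simp only [G]
    rcases lt_trichotomy (a : ℕ) l with h | h | h
    · rw [if_pos h, lowSites_insertLast_of_le a σ h.le, card_highSites_insertLast_of_lt a σ h]
    · rw [if_neg (by omega), if_pos h, lowSites_insertLast_of_le a σ h.le,
        card_highSites_insertLast_of_eq a σ hσ h, filter_true_of_mem, Nat.add_sub_cancel]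
      intro b hb
      rw [h]
      exact (mem_lowSites.1 hb).1
    · rw [if_neg (by omega), if_neg (by omega), lowSites_insertLast_of_gt a σ hσ h,
        card_highSites_insertLast_of_gt a σ h, card_insert_of_notMem]
      simp [mem_lowSites]
  simp only [hG]
  rw [Fin.sum_univ_eq_sum_range (fun a ↦ if ¬ BadSite σ a then G a else 0) (m + 2),
    ← sum_filter]
  have hlow : l ∉ lowSites σ := by simp [mem_lowSites, hl]
  have hdisj : Disjoint (insert l (lowSites σ)) (highSites σ) := by
    rw [disjoint_left]
    intro b hb hb'
    rw [mem_insert, mem_lowSites] at hb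
    rw [mem_highSites] at hb'
    omega
  have hset : {a ∈ range (m + 2) | ¬ BadSite σ a} = insert l (lowSites σ) ∪ highSites σ := by
    ext b
    rw [mem_filter, mem_range, mem_union, mem_insert, mem_lowSites, mem_highSites]
    rcases lt_trichotomy b l with h | h | h
    · have h1 : b < m + 2 := by omega
      have h2 : ¬ b = l := by omega
      have h3 : ¬ l < b := by omega
      simp [h, h1, h2, h3, ← hl]
    · have h1 : b < m + 2 := by omega
      have h2 : ¬ BadSite σ b := h ▸ not_badSite_last σ hσ
      exact ⟨fun _ ↦ Or.inl (Or.inl h), fun _ ↦ ⟨h1, h2⟩⟩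
    · have h2 : ¬ b = l := by omega
      have h3 : ¬ b < l := by omega
      simp [h, h2, h3, ← hl]
      omega
  rw [hset, sum_union hdisj, sum_insert hlow, ← sum_card_filter_lt (lowSites σ)
    (fun t ↦ F t (#(highSites σ) - 1)), ← sum_card_filter_ge (highSites σ), add_comm (G l)]
  congr 1
  · congr 1
    · refine sum_congr rfl fun a ha ↦ ?_
      simp only [G]
      rw [if_pos (mem_lowSites.1 ha).1]
    · simp [G]
  · refine sum_congr rfl fun a ha ↦ ?_
    have := (mem_highSites.1 ha).1.1
    simp only [G]
    rw [if_neg (by omega), if_neg (by omega)]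

/-! ### Binomial moments of the labels -/

/-- The binomial coefficient with an integer lower index. -/
def intChoose (p : ℕ) (x : ℤ) : ℕ := if 0 ≤ x then p.choose x.toNat else 0

lemma intChoose_succ (p : ℕ) (x : ℤ) :
    intChoose (p + 1) x = intChoose p x + intChoose p (x - 1) := by
  unfold intChoose
  rcases lt_trichotomy x 0 with h | rfl | h
  · rw [if_neg (by omega), if_neg (by omega), if_neg (by omega)]
  · simp
  · obtain ⟨k, rfl⟩ : ∃ k : ℕ, x = k + 1 := ⟨(x - 1).toNat, by omega⟩
    rw [if_pos (by omega), if_pos (by omega), if_pos (by omega),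
      show ((k : ℤ) + 1).toNat = k + 1 by omega, show ((k : ℤ) + 1 - 1).toNat = k by omega,
      Nat.choose_succ_succ, add_comm]

lemma intChoose_zero (x : ℤ) : intChoose 0 x = if x = 0 then 1 else 0 := by
  unfold intChoose
  rcases lt_trichotomy x 0 with h | rfl | h
  · rw [if_neg (by omega), if_neg (by omega)]
  · simp
  · rw [if_pos (by omega), if_neg (by omega), Nat.choose_eq_zero_of_lt (by omega)]

lemma sum_range_intChoose (p : ℕ) (x : ℤ) (hx : 0 ≤ x) :
    ∑ t ∈ range p, intChoose t x = intChoose p (x + 1) := by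
  induction p with
  | zero => simp [intChoose_zero, show x + 1 ≠ 0 by omega]
  | succ p ih => rw [sum_range_succ, ih, intChoose_succ, add_sub_cancel_right]

open Classical in
/-- The binomial moments of the labels of the strong-Baxter permutations of size `m + 1`. -/
noncomputable def labelMoment (m : ℕ) (x y : ℤ) : ℕ :=
  ∑ σ : Equiv.Perm (Fin (m + 1)), if IsStrongBaxter σ then
    intChoose #(lowSites σ) x * intChoose (#(highSites σ) - 1) y else 0

lemma labelMoment_of_not_nonneg (m : ℕ) (x y : ℤ) (h : ¬ (0 ≤ x ∧ 0 ≤ y)) :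
    labelMoment m x y = 0 := by
  refine sum_eq_zero fun σ _ ↦ ?_
  rw [not_and_or] at h
  rcases h with h | h <;> simp [intChoose, h]

lemma labelMoment_zero (x y : ℤ) : labelMoment 0 x y = if (x, y) = (0, 0) then 1 else 0 := by
  have hbad : ∀ (σ : Equiv.Perm (Fin 1)) (b : ℕ), ¬ BadSite σ b := by
    rintro σ b ⟨i, j, j', h, -⟩
    omega
  have hstrong : ∀ σ : Equiv.Perm (Fin 1), IsStrongBaxter σ := by
    intro σ
    rw [isStrongBaxter_iff]
    rintro ⟨i, j, j', k, h, -⟩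
    omega
  have : Unique (Equiv.Perm (Fin (0 + 1))) := inferInstanceAs (Unique (Equiv.Perm (Fin 1)))
  rw [labelMoment, Fintype.sum_unique, if_pos (hstrong _)]
  simp only [lowSites, highSites, hbad]
  simp [intChoose_zero, ← ite_and, and_comm]

lemma labelMoment_succ (m : ℕ) (x y : ℤ) (hx : 0 ≤ x) (hy : 0 ≤ y) :
    labelMoment (m + 1) x y = ∑ s : Fin 7,
      labelMoment m (x - (stepS2 s).1) (y - (stepS2 s).2) := by
  classical
  rw [labelMoment, ← (insertLast_bijective (m + 1)).sum_comp, Fintype.sum_prod_type_right]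
  simp only [labelMoment]
  rw [sum_comm (s := (univ : Finset (Fin 7)))]
  refine sum_congr rfl fun σ _ ↦ ?_
  by_cases hσ : IsStrongBaxter σ
  · simp only [isStrongBaxter_insertLast, hσ, true_and, if_true]
    rw [sum_children σ hσ fun p q ↦ intChoose p x * intChoose q y, ← sum_mul, ← mul_sum,
      sum_range_intChoose _ _ hx, sum_range_intChoose _ _ hy]
    obtain ⟨q, hq⟩ : ∃ q, #(highSites σ) = q + 1 :=
      ⟨_, (Nat.succ_pred_eq_of_pos (card_highSites_pos σ)).symm⟩
    simp only [hq, Nat.add_sub_cancel, intChoose_succ, add_sub_cancel_right]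
    simp [Fin.sum_univ_succ, stepS2]
    ring
  · simp [isStrongBaxter_insertLast, hσ]

lemma labelMoment_zero_zero (m : ℕ) : labelMoment m 0 0 = strongBaxterCount (m + 1) := by
  classical
  simp [labelMoment, strongBaxterCount, intChoose, Nat.card_eq_fintype_card,
    Fintype.card_subtype]

/-! ### The recurrence for quarter-plane walks -/

section Walks

variable {σ : Type} (step : σ → ℤ × ℤ)

/-- Walks staying in the quarter plane and ending at `p`. -/
def IsQuarterWalk (n : ℕ) (p : ℤ × ℤ) (w : Fin n → σ) : Prop :=
  (∀ r : ℕ, r ≤ n →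
    0 ≤ (∑ t : Fin n, if (t : ℕ) < r then step (w t) else 0).1 ∧
    0 ≤ (∑ t : Fin n, if (t : ℕ) < r then step (w t) else 0).2) ∧
  (∑ t : Fin n, step (w t)) = p

lemma walkCount_eq (n : ℕ) (p : ℤ × ℤ) :
    walkCount step n p = Nat.card {w : Fin n → σ // IsQuarterWalk step n p w} := rfl

lemma IsQuarterWalk.nonneg {n : ℕ} {p : ℤ × ℤ} {w : Fin n → σ}
    (h : IsQuarterWalk step n p w) : 0 ≤ p.1 ∧ 0 ≤ p.2 := by
  simpa [h.2] using h.1 n le_rfl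

lemma walkCount_of_not_nonneg (n : ℕ) (p : ℤ × ℤ) (hp : ¬ (0 ≤ p.1 ∧ 0 ≤ p.2)) :
    walkCount step n p = 0 := by
  rw [walkCount_eq]
  have : IsEmpty {w : Fin n → σ // IsQuarterWalk step n p w} := ⟨fun w ↦ hp w.2.nonneg⟩
  exact Nat.card_of_isEmpty

lemma isQuarterWalk_snoc (n : ℕ) (p : ℤ × ℤ) (hp : 0 ≤ p.1 ∧ 0 ≤ p.2) (w : Fin n → σ) (s : σ) :
    IsQuarterWalk step (n + 1) p (Fin.snoc w s) ↔ IsQuarterWalk step n (p - step s) w := by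
  simp only [IsQuarterWalk, Fin.sum_univ_castSucc, Fin.snoc_castSucc, Fin.snoc_last,
    Fin.val_castSucc, Fin.val_last, eq_sub_iff_add_eq]
  refine and_congr_left fun h ↦ ⟨fun H r hr ↦ ?_, fun H r hr ↦ ?_⟩
  · have := H r (by omega)
    rwa [if_neg (by omega), add_zero] at this
  · rcases hr.lt_or_eq with h1 | rfl
    · rw [if_neg (by omega), add_zero]
      exact H r (by omega)
    · have h2 : ∀ t : Fin n, (t : ℕ) < n + 1 := fun t ↦ by omega
      simp only [h2, if_true, Nat.lt_succ_self, h]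
      exact hp

lemma walkCount_succ [Fintype σ] (n : ℕ) (p : ℤ × ℤ) (hp : 0 ≤ p.1 ∧ 0 ≤ p.2) :
    walkCount step (n + 1) p = ∑ s : σ, walkCount step n (p - step s) := by
  simp only [walkCount_eq]
  rw [← Nat.card_sigma]
  refine Nat.card_congr (Equiv.trans ?_ (Equiv.subtypeProdEquivSigmaSubtype
    fun s w ↦ IsQuarterWalk step n (p - step s) w))
  refine ((Fin.snocEquiv fun _ ↦ σ).subtypeEquiv fun x ↦ ?_).symm
  exact (isQuarterWalk_snoc step n p hp x.2 x.1).symm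

lemma walkCount_zero (p : ℤ × ℤ) : walkCount step 0 p = if p = (0, 0) then 1 else 0 := by
  rw [walkCount_eq]
  split_ifs with h
  · subst h
    have : Unique {w : Fin 0 → σ // IsQuarterWalk step 0 (0, 0) w} :=
      { default := ⟨Fin.elim0, by simp [IsQuarterWalk, Prod.ext_iff]⟩
        uniq := fun w ↦ Subtype.ext (Subsingleton.elim _ _) }
    exact Nat.card_unique
  · have : IsEmpty {w : Fin 0 → σ // IsQuarterWalk step 0 p w} :=
      ⟨fun w ↦ h (by simpa [Prod.ext_iff, eq_comm] using w.2.2)⟩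
    exact Nat.card_of_isEmpty

end Walks

lemma labelMoment_eq_walkCount (n : ℕ) (x y : ℤ) :
    labelMoment n x y = walkCount stepS2 n (x, y) := by
  induction n generalizing x y with
  | zero => rw [labelMoment_zero, walkCount_zero]
  | succ n ih =>
    by_cases h : 0 ≤ x ∧ 0 ≤ y
    · rw [labelMoment_succ n x y h.1 h.2, walkCount_succ stepS2 n (x, y) h]
      exact sum_congr rfl fun s _ ↦ ih _ _
    · rw [labelMoment_of_not_nonneg _ _ _ h, walkCount_of_not_nonneg _ _ _ h]

/-- Consequence of eq. (JW2) of Lemma 5.6 at `a = b = 0`: strong-Baxter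
permutations of size `n+1` are equinumerous with quarter-plane excursions of
length `n` with step multiset `S₂`. -/
theorem strongBaxter_eq_excursions (n : ℕ) :
    strongBaxterCount (n + 1) = walkCount stepS2 n (0, 0) := by
  rw [← labelMoment_zero_zero, labelMoment_eq_walkCount]
end
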